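/- arXiv:1707.07366 — 3 statements merged into one kernel-verified Lean document; each statement's English description precedes it below -/
import Mathlib

section
/- Let $F$ be a perfect field, $V$ a finite-dimensional $F$-vector space, $G \subseteq \mathrm{GL}(V)$ a subgroup, $V^{ss}$ the semisimplification of $V$ as a $G$-representation, and $G^{red}$ the image of $G$ in $\mathrm{GL}(V^{ss})$. Then $\dim_F \mathrm{End}_G(V) \leq \dim_F \mathrm{End}_{G^{red}}(V^{ss})$. -/
open Module

/-- A set `S` of linear automorphisms acts semisimply on `V` if every `S`-stable subspace
has an `S`-stable complement. -/
def ActsSemisimply {F V : Type} [Field F] [AddCommGroup V] [Module F V]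
    (S : Set (V ≃ₗ[F] V)) : Prop :=
  ∀ U : Submodule F V, (∀ g ∈ S, ∀ x ∈ U, g x ∈ U) →
    ∃ U' : Submodule F V, (∀ g ∈ S, ∀ x ∈ U', g x ∈ U') ∧ IsCompl U U'

/-- The commutant (centralizer) of a set of automorphisms inside `End_F(V)`. -/
noncomputable def commutantDim {F V : Type} [Field F] [AddCommGroup V] [Module F V]
    (S : Set (V ≃ₗ[F] V)) : ℕ :=
  Module.finrank F
    (Subalgebra.centralizer F ((fun g : V ≃ₗ[F] V => (g : Module.End F V)) '' S) :
      Subalgebra F (Module.End F V))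

universe u

theorem LinearMap.charpoly_eq_charpoly_mul_charpoly {R V : Type*} [CommRing R] [AddCommGroup V]
    [Module R V] [Module.Finite R V] [Module.Free R V] (W : Submodule R V) [Module.Free R W]
    [Module.Finite R W] [Module.Free R (V ⧸ W)] (e : V →ₗ[R] V) (he : W ≤ W.comap e) :
    e.charpoly = (e.restrict he).charpoly * (W.mapQ W e he).charpoly := by
  let bW := Module.Free.chooseBasis R W
  let bQ := Module.Free.chooseBasis R (V ⧸ W)
  let b := Basis.sumQuot bW bQ
  have h : LinearMap.toMatrix b b e = Matrix.fromBlocks (LinearMap.toMatrix bW bW (e.restrict he))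
      (Matrix.of fun i l => b.repr (e (b (Sum.inr l))) (Sum.inl i)) 0
      (LinearMap.toMatrix bQ bQ (W.mapQ W e he)) := by
    ext (i | j) (k | l)
    · simp only [b, Basis.sumQuot_inl, Matrix.fromBlocks_apply₁₁, LinearMap.toMatrix_apply]
      apply Basis.sumQuot_repr_inl_of_mem
    · simp [LinearMap.toMatrix_apply]
    · have : W.mkQ (e (bW k)) = 0 := by
        rw [← LinearMap.mem_ker, Submodule.ker_mkQ]
        exact he (Submodule.coe_mem (bW k))
      simp [LinearMap.toMatrix_apply, b, this]
    · simp only [LinearMap.toMatrix_apply, Basis.sumQuot_repr_inr, Matrix.fromBlocks_apply₂₂, b]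
      rw [← Basis.sumQuot_inr bW bQ l, W.mapQ_apply]
      simp
  rw [← LinearMap.charpoly_toMatrix e b, h, Matrix.charpoly_fromBlocks_zero₂₁,
    LinearMap.charpoly_toMatrix, LinearMap.charpoly_toMatrix]

theorem LinearMap.trace_eq_neg_charpoly_nextCoeff {R V : Type*} [CommRing R] [AddCommGroup V]
    [Module R V] [Module.Finite R V] [Module.Free R V] (f : V →ₗ[R] V) :
    LinearMap.trace R V f = -f.charpoly.nextCoeff := by
  rw [LinearMap.trace_eq_matrix_trace R (Module.Free.chooseBasis R V),
    Matrix.trace_eq_neg_charpoly_nextCoeff, LinearMap.charpoly_toMatrix]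

section FiniteDimensionalModules

variable {K A : Type*} [Field K] [Ring A] [Algebra K A]

/-- The trace of the action of an element of a `K`-algebra `A` on an `A`-module. -/
noncomputable def moduleTrace (K : Type*) {A : Type*} (M : Type*) [Field K] [Ring A] [Algebra K A]
    [AddCommGroup M] [Module K M] [Module A M] [IsScalarTower K A M] : A →ₗ[K] K :=
  LinearMap.trace K M ∘ₗ (Algebra.lsmul K K M : A →ₐ[K] End K M).toLinearMap

/-- The characteristic polynomial of the action of `a : A` on an `A`-module. -/
noncomputable def moduleCharpoly (K : Type*) {A : Type*} (M : Type*) [Field K] [Ring A]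
    [Algebra K A] [AddCommGroup M] [Module K M] [Module A M] [IsScalarTower K A M]
    [FiniteDimensional K M] (a : A) : Polynomial K :=
  (Algebra.lsmul K K M a).charpoly

section

variable {M N : Type*} [AddCommGroup M] [Module K M] [Module A M] [IsScalarTower K A M]
  [AddCommGroup N] [Module K N] [Module A N] [IsScalarTower K A N]

theorem moduleTrace_congr (e : M ≃ₗ[A] N) (a : A) : moduleTrace K M a = moduleTrace K N a := by
  have h : Algebra.lsmul K K N a = (e.restrictScalars K).conj (Algebra.lsmul K K M a) := by
    ext x; simp
  simp [moduleTrace, h]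

theorem moduleTrace_prod [FiniteDimensional K M] [FiniteDimensional K N] (a : A) :
    moduleTrace K (M × N) a = moduleTrace K M a + moduleTrace K N a := by
  have h : Algebra.lsmul K K (M × N) a =
      (Algebra.lsmul K K M a).prodMap (Algebra.lsmul K K N a) := by
    ext x <;> simp
  simp only [moduleTrace, LinearMap.comp_apply, AlgHom.toLinearMap_apply, h,
    LinearMap.trace_prodMap']

theorem moduleTrace_of_subsingleton [Subsingleton M] (a : A) : moduleTrace K M a = 0 := by
  have h : Algebra.lsmul K K M a = 0 := Subsingleton.elim _ _
  simp [moduleTrace, h]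

theorem moduleTrace_fun [FiniteDimensional K M] (n : ℕ) (a : A) :
    moduleTrace K (Fin n → M) a = n * moduleTrace K M a := by
  induction n with
  | zero => simp [moduleTrace_of_subsingleton]
  | succ n ih =>
    rw [← moduleTrace_congr (Fin.consLinearEquiv A fun _ => M), moduleTrace_prod, ih]
    push_cast
    ring

variable [FiniteDimensional K M] [FiniteDimensional K N]

theorem moduleCharpoly_congr (e : M ≃ₗ[A] N) (a : A) :
    moduleCharpoly K M a = moduleCharpoly K N a := by
  have h : Algebra.lsmul K K N a = (e.restrictScalars K).conj (Algebra.lsmul K K M a) := by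
    ext x; simp
  simp only [moduleCharpoly, h, LinearEquiv.charpoly_conj]

theorem moduleCharpoly_prod (a : A) :
    moduleCharpoly K (M × N) a = moduleCharpoly K M a * moduleCharpoly K N a := by
  have h : Algebra.lsmul K K (M × N) a =
      (Algebra.lsmul K K M a).prodMap (Algebra.lsmul K K N a) := by
    ext x <;> simp
  simp only [moduleCharpoly, h, LinearMap.charpoly_prodMap]

theorem natDegree_moduleCharpoly (a : A) : (moduleCharpoly K M a).natDegree = finrank K M :=
  LinearMap.charpoly_natDegree _

theorem moduleCharpoly_ne_zero (a : A) : moduleCharpoly K M a ≠ 0 :=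
  (LinearMap.charpoly_monic _).ne_zero

theorem moduleCharpoly_fun (n : ℕ) (a : A) :
    moduleCharpoly K (Fin n → M) a = moduleCharpoly K M a ^ n := by
  induction n with
  | zero =>
    have h := LinearMap.charpoly_monic (Algebra.lsmul K K (Fin 0 → M) a)
    rw [pow_zero]
    refine h.natDegree_eq_zero.mp ?_
    rw [LinearMap.charpoly_natDegree]
    exact finrank_zero_of_subsingleton
  | succ n ih =>
    rw [← moduleCharpoly_congr (Fin.consLinearEquiv A fun _ => M), moduleCharpoly_prod, ih,
      pow_succ']

theorem moduleTrace_eq_of_moduleCharpoly_eq {a : A}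
    (h : moduleCharpoly K M a = moduleCharpoly K N a) : moduleTrace K M a = moduleTrace K N a := by
  simp only [moduleTrace, LinearMap.comp_apply, AlgHom.toLinearMap_apply]
  rw [LinearMap.trace_eq_neg_charpoly_nextCoeff, LinearMap.trace_eq_neg_charpoly_nextCoeff]
  exact congrArg (fun p => -p.nextCoeff) h

end

theorem isSemisimpleModule_prod {R M N : Type*} [Ring R] [AddCommGroup M] [Module R M]
    [AddCommGroup N] [Module R N] [IsSemisimpleModule R M] [IsSemisimpleModule R N] :
    IsSemisimpleModule R (M × N) := by
  have hM := IsSemisimpleModule.range (LinearMap.inl R M N)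
  have hN := IsSemisimpleModule.range (LinearMap.inr R M N)
  have h := IsSemisimpleModule.sup hM hN
  rw [LinearMap.sup_range_inl_inr] at h
  exact IsSemisimpleModule.congr Submodule.topEquiv.symm

section

variable {M N : Type*} [AddCommGroup M] [Module K M] [Module A M] [IsScalarTower K A M]
  [AddCommGroup N] [Module K N] [Module A N] [IsScalarTower K A N]
  [FiniteDimensional K M]

theorem LinearMap.eq_zero_of_forall_eq_zero_of_isSemisimpleModule
    {R M N : Type*} [Ring R] [AddCommGroup M] [Module R M] [AddCommGroup N] [Module R N]
    [IsSemisimpleModule R M] [IsSemisimpleModule R N]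
    (h : ∀ f : M →ₗ[R] N, f = 0) (g : N →ₗ[R] M) : g = 0 := by
  obtain ⟨s, hs⟩ := IsSemisimpleModule.lifting_property g.rangeRestrict
    (LinearMap.surjective_rangeRestrict g) LinearMap.id
  obtain ⟨C, hC⟩ := exists_isCompl (LinearMap.range g)
  have h0 := h (s ∘ₗ (LinearMap.range g).projectionOnto C hC)
  have hs0 : ∀ y, s y = 0 := fun y => by
    simpa using LinearMap.congr_fun h0 y
  ext x
  have := LinearMap.congr_fun hs (g.rangeRestrict x)
  simp only [LinearMap.comp_apply, hs0, map_zero, LinearMap.id_apply] at this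
  simpa using congrArg Subtype.val this.symm

theorem exists_smul_eq_and_smul_eq_zero [FiniteDimensional K N] [IsSemisimpleModule A M]
    [IsSemisimpleModule A N] (h : ∀ f : M →ₗ[A] N, f = 0) (φ : M →ₗ[K] M)
    (hφ : ∀ (f : End A M) (x : M), φ (f x) = f (φ x)) :
    ∃ a : A, (∀ x : M, a • x = φ x) ∧ ∀ y : N, a • y = 0 := by
  have h' := LinearMap.eq_zero_of_forall_eq_zero_of_isSemisimpleModule h
  have hss : IsSemisimpleModule A (M × N) := isSemisimpleModule_prod
  have hfin : Module.Finite (End A (M × N)) (M × N) :=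
    Module.Finite.of_restrictScalars_finite K _ _
  let ψ : End (End A (M × N)) (M × N) :=
    { toFun := fun z => (φ z.1, 0)
      map_add' := fun x y => by simp
      map_smul' := fun f z => by
        have h1 : ∀ y, (f (0, y)).1 = 0 := fun y => LinearMap.congr_fun
          (h' (LinearMap.fst A M N ∘ₗ f ∘ₗ LinearMap.inr A M N)) y
        have h2 : ∀ x, (f (x, 0)).2 = 0 := fun x => LinearMap.congr_fun
          (h (LinearMap.snd A M N ∘ₗ f ∘ₗ LinearMap.inl A M N)) x
        have h3 : (f z).1 = (f (z.1, 0)).1 := by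
          have : z = (z.1, 0) + (0, z.2) := by simp
          conv_lhs => rw [this, map_add, Prod.fst_add, h1, add_zero]
        have h4 := hφ (LinearMap.fst A M N ∘ₗ f ∘ₗ LinearMap.inl A M N) z.1
        simp only [LinearMap.comp_apply, LinearMap.inl_apply, LinearMap.fst_apply] at h4
        ext
        · simp [h3, h4]
        · simp [h2] }
  obtain ⟨a, ha⟩ := Module.Finite.toModuleEnd_moduleEnd_surjective (R := A) (M := M × N) ψ
  refine ⟨a, fun x => ?_, fun y => ?_⟩
  · simpa [ψ] using congrArg Prod.fst (LinearMap.congr_fun ha (x, 0))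
  · simpa [ψ] using congrArg Prod.snd (LinearMap.congr_fun ha (0, y))

theorem moduleTrace_eq_zero_of_forall_eq_zero [FiniteDimensional K N] [IsSemisimpleModule A M]
    [IsSemisimpleModule A N] (h : ∀ f : M →ₗ[A] N, f = 0)
    (htr : ∀ a : A, moduleTrace K M a = moduleTrace K N a) (a : A) : moduleTrace K M a = 0 := by
  obtain ⟨e, heM, heN⟩ := exists_smul_eq_and_smul_eq_zero (K := K) h LinearMap.id (by simp)
  have hM : moduleTrace K M (a * e) = moduleTrace K M a := by
    have : Algebra.lsmul K K M (a * e) = Algebra.lsmul K K M a := by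
      ext x; simp [heM]
    simp [moduleTrace, this]
  have hN : moduleTrace K N (a * e) = 0 := by
    have : Algebra.lsmul K K N (a * e) = 0 := by
      ext x; simp [heN]
    simp [moduleTrace, this]
  rw [← hM, htr, hN]

end

theorem exists_linearEquiv_fun_prod {R M : Type*} [Ring R] [AddCommGroup M] [Module R M]
    [Module.Finite R M] [IsSemisimpleModule R M] (S : Submodule R M) [IsSimpleModule R S] :
    ∃ (n : ℕ) (C : Submodule R M), C ≠ ⊤ ∧ Nonempty (M ≃ₗ[R] (Fin n → S) × C) ∧
      ∀ f : S →ₗ[R] C, f = 0 := by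
  obtain ⟨C, hC⟩ := exists_isCompl (isotypicComponent R M S)
  obtain ⟨n, ⟨e⟩⟩ := (IsIsotypicOfType.isotypicComponent R M S).linearEquiv_fun
  refine ⟨n, C, ?_, ⟨(Submodule.prodEquivOfIsCompl _ _ hC).symm.trans
    (e.prodCongr (LinearEquiv.refl R C))⟩, fun f => ?_⟩
  · rintro rfl
    exact (bot_lt_isotypicComponent S).ne' (by simpa using hC.inf_eq_bot)
  · obtain inj | eq := (C.subtype ∘ₗ f).injective_or_eq_zero
    · have h1 : LinearMap.range (C.subtype ∘ₗ f) ≤ isotypicComponent R M S :=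
        le_sSup ⟨(LinearEquiv.ofInjective _ inj).symm⟩
      have h2 : LinearMap.range (C.subtype ∘ₗ f) ≤ C := by
        rintro _ ⟨x, rfl⟩
        exact (f x).2
      have h3 := hC.disjoint h1 h2
      rw [le_bot_iff, LinearMap.range_eq_bot] at h3
      ext x
      exact LinearMap.congr_fun h3 x
    · ext x
      exact LinearMap.congr_fun eq x

instance finiteDimensional_submodule {M : Type*} [AddCommGroup M] [Module K M] [Module A M]
    [IsScalarTower K A M] [FiniteDimensional K M] (N : Submodule A M) : FiniteDimensional K N :=
  inferInstanceAs (FiniteDimensional K (N.restrictScalars K))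

theorem finrank_submodule_lt {M : Type*} [AddCommGroup M] [Module K M] [Module A M]
    [IsScalarTower K A M] [FiniteDimensional K M] {N : Submodule A M} (hN : N ≠ ⊤) :
    finrank K N < finrank K M :=
  Submodule.finrank_lt (s := N.restrictScalars K) fun h => hN (by simpa using h)

/-- Over an algebraically closed field, a semisimple module with vanishing trace form is a
`p`-fold power, where `p` is the characteristic of the field. -/
theorem exists_linearEquiv_fun_of_moduleTrace_eq_zero [IsAlgClosed K] (p : ℕ) [CharP K p]
    (M : Type u) [AddCommGroup M] [Module K M] [Module A M] [IsScalarTower K A M]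
    [FiniteDimensional K M] [IsSemisimpleModule A M] (h : ∀ a : A, moduleTrace K M a = 0) :
    ∃ (U : Type u) (_ : AddCommGroup U) (_ : Module K U) (_ : Module A U)
      (_ : IsScalarTower K A U), FiniteDimensional K U ∧ IsSemisimpleModule A U ∧
      Nonempty (M ≃ₗ[A] (Fin p → U)) := by
  induction hn : finrank K M using Nat.strong_induction_on generalizing M with
  | _ n ih =>
  rcases subsingleton_or_nontrivial M with hM | hM
  · exact ⟨M, _, _, _, inferInstance, inferInstance, inferInstance,
      ⟨0, 0, fun _ => Subsingleton.elim _ _, fun _ => Subsingleton.elim _ _⟩⟩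
  have : Module.Finite A M := Module.Finite.of_restrictScalars_finite K A M
  obtain ⟨S, hS⟩ := IsSemisimpleModule.exists_simple_submodule A M
  obtain ⟨m, C, hC, ⟨e⟩, hSC⟩ := exists_linearEquiv_fun_prod S
  have htr (a : A) : m * moduleTrace K S a + moduleTrace K C a = 0 := by
    rw [← h a, moduleTrace_congr e, moduleTrace_prod, moduleTrace_fun]
  have hSnt : Nontrivial S := IsSimpleModule.nontrivial A S
  obtain ⟨x, hx⟩ := exists_ne (0 : S)
  obtain ⟨l, hl⟩ := Projective.exists_dual_eq_one K hx
  obtain ⟨a, haS, haC⟩ := exists_smul_eq_and_smul_eq_zero (K := K) hSC (l.smulRight x) (by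
    intro f y
    obtain ⟨c, rfl⟩ := (IsSimpleModule.algebraMap_end_bijective_of_isAlgClosed K).2 f
    simp [smul_comm c])
  have ha := htr a
  have h1 : moduleTrace K S a = 1 := by
    have : Algebra.lsmul K K S a = l.smulRight x := by
      ext x; simp [haS]
    simp [moduleTrace, this, LinearMap.trace_smulRight, hl]
  have h2 : moduleTrace K C a = 0 := by
    have : Algebra.lsmul K K C a = 0 := by
      ext x; simp [haC]
    simp [moduleTrace, this]
  rw [h1, h2, mul_one, add_zero, CharP.cast_eq_zero_iff K p] at ha
  obtain ⟨k, rfl⟩ := ha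
  obtain ⟨U, _, _, _, _, _, _, ⟨e'⟩⟩ := ih (finrank K C) (hn ▸ finrank_submodule_lt hC) C
    (fun b => by simpa [CharP.cast_eq_zero] using htr b) rfl
  refine ⟨(Fin k → S) × U, inferInstance, inferInstance, inferInstance, inferInstance,
    inferInstance, isSemisimpleModule_prod, ?_⟩
  let e₁ : (Fin (p * k) → S) ≃ₗ[A] (Fin p × Fin k → S) :=
    LinearEquiv.funCongrLeft A S finProdFinEquiv
  let e₂ : (Fin (p * k) → S) ≃ₗ[A] (Fin p → Fin k → S) :=
    e₁.trans (LinearEquiv.curry A S (Fin p) (Fin k))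
  let e₃ : ((Fin p → Fin k → S) × (Fin p → U)) ≃ₗ[A] (Fin p → (Fin k → S) × U) :=
    { toFun := fun f i => (f.1 i, f.2 i)
      invFun := fun f => (fun i => (f i).1, fun i => (f i).2)
      map_add' := fun _ _ => rfl
      map_smul' := fun _ _ => rfl }
  exact ⟨e.trans ((e₂.prodCongr e').trans e₃)⟩

theorem exists_linearEquiv_ker_prod_range {R M N : Type*} [Ring R] [AddCommGroup M] [Module R M]
    [AddCommGroup N] [Module R N] [IsSemisimpleModule R M] (f : M →ₗ[R] N) :
    Nonempty (M ≃ₗ[R] LinearMap.ker f × LinearMap.range f) := by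
  obtain ⟨C, hC⟩ := exists_isCompl (LinearMap.ker f)
  exact ⟨(Submodule.prodEquivOfIsCompl _ _ hC).symm.trans ((LinearEquiv.refl R _).prodCongr
    ((Submodule.quotientEquivOfIsCompl _ _ hC).symm.trans f.quotKerEquivRange))⟩

/-- **Brauer–Nesbitt theorem** over an algebraically closed field: two semisimple modules are
isomorphic if a spanning set of the algebra acts on them with the same characteristic
polynomials. -/
theorem nonempty_linearEquiv_of_moduleCharpoly_eq [IsAlgClosed K] {T : Set A} (h1 : 1 ∈ T)
    (hT : Submodule.span K T = ⊤)
    (M N : Type u) [AddCommGroup M] [Module K M] [Module A M] [IsScalarTower K A M]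
    [FiniteDimensional K M] [IsSemisimpleModule A M]
    [AddCommGroup N] [Module K N] [Module A N] [IsScalarTower K A N]
    [FiniteDimensional K N] [IsSemisimpleModule A N]
    (h : ∀ a ∈ T, moduleCharpoly K M a = moduleCharpoly K N a) : Nonempty (M ≃ₗ[A] N) := by
  induction hn : finrank K M using Nat.strong_induction_on generalizing M N with
  | _ n ih =>
  have hdim : finrank K M = finrank K N := by
    rw [← natDegree_moduleCharpoly (1 : A), h 1 h1, natDegree_moduleCharpoly]
  rcases subsingleton_or_nontrivial M with hM | hM
  · have hN : Subsingleton N := by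
      rw [← finrank_zero_iff (R := K), ← hdim, finrank_zero_iff]
      exact hM
    exact ⟨0, 0, fun _ => Subsingleton.elim _ _, fun _ => Subsingleton.elim _ _⟩
  by_cases hMN : ∀ f : M →ₗ[A] N, f = 0
  · obtain ⟨p, hp⟩ := CharP.exists K
    have htr (a : A) : moduleTrace K M a = moduleTrace K N a := by
      have : moduleTrace K M = moduleTrace K N :=
        LinearMap.ext_on hT fun a ha => moduleTrace_eq_of_moduleCharpoly_eq (h a ha)
      rw [this]
    have hM0 := moduleTrace_eq_zero_of_forall_eq_zero hMN htr
    obtain ⟨U, _, _, _, _, _, _, ⟨e⟩⟩ := exists_linearEquiv_fun_of_moduleTrace_eq_zero p M hM0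
    obtain ⟨U', _, _, _, _, _, _, ⟨e'⟩⟩ :=
      exists_linearEquiv_fun_of_moduleTrace_eq_zero p N fun a => by rw [← htr, hM0]
    rcases CharP.char_is_prime_or_zero K p with hprime | rfl
    · have : Fact p.Prime := ⟨hprime⟩
      have hlt : finrank K U < n := by
        have hMU : finrank K M = p * finrank K U := by
          rw [(e.restrictScalars K).finrank_eq]
          rw [finrank_pi_fintype]
          simp
        have : 0 < finrank K M := finrank_pos
        have := hprime.two_le
        nlinarith
      obtain ⟨g⟩ := ih _ hlt U U' (fun a ha => by
        apply frobenius_inj (Polynomial K) p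
        rw [frobenius_def, frobenius_def, ← moduleCharpoly_fun, ← moduleCharpoly_fun,
          ← moduleCharpoly_congr e, ← moduleCharpoly_congr e', h a ha]) rfl
      exact ⟨e.trans ((LinearEquiv.piCongrRight fun _ => g).trans e'.symm)⟩
    · exact (not_subsingleton M e.injective.subsingleton).elim
  · push Not at hMN
    obtain ⟨f, hf⟩ := hMN
    obtain ⟨e⟩ := exists_linearEquiv_ker_prod_range f
    obtain ⟨C, hC⟩ := exists_isCompl (LinearMap.range f)
    let e' := Submodule.prodEquivOfIsCompl _ _ hC
    have hker : LinearMap.ker f ≠ ⊤ := fun h => hf (LinearMap.ker_eq_top.mp h)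
    obtain ⟨g⟩ := ih _ (hn ▸ finrank_submodule_lt hker) (LinearMap.ker f) C (fun a ha => by
      have := h a ha
      rw [moduleCharpoly_congr e, ← moduleCharpoly_congr e', moduleCharpoly_prod,
        moduleCharpoly_prod, mul_comm] at this
      exact mul_left_cancel₀ (moduleCharpoly_ne_zero a) this) rfl
    exact ⟨e.trans ((LinearEquiv.prodComm A _ _).trans
      (((LinearEquiv.refl A _).prodCongr g).trans e'))⟩

theorem finrank_le_add_of_ker_le_range {U V W : Type*} [AddCommGroup U] [Module K U]
    [AddCommGroup V] [Module K V] [AddCommGroup W] [Module K W] [FiniteDimensional K U]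
    [FiniteDimensional K V] [FiniteDimensional K W] {α : U →ₗ[K] V} {β : V →ₗ[K] W}
    (h : LinearMap.ker β ≤ LinearMap.range α) : finrank K V ≤ finrank K W + finrank K U := by
  rw [← β.finrank_range_add_finrank_ker]
  exact add_le_add (Submodule.finrank_le _) ((Submodule.finrank_mono h).trans α.finrank_range_le)

theorem finrank_linearMap_congr {P Q P' Q' : Type*} [AddCommGroup P] [Module A P]
    [AddCommGroup Q] [Module K Q] [Module A Q] [IsScalarTower K A Q]
    [AddCommGroup P'] [Module A P']
    [AddCommGroup Q'] [Module K Q'] [Module A Q'] [IsScalarTower K A Q']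
    (e : P ≃ₗ[A] P') (e' : Q ≃ₗ[A] Q') :
    finrank K (P →ₗ[A] Q) = finrank K (P' →ₗ[A] Q') :=
  LinearEquiv.finrank_eq
    { toFun := fun f => e' ∘ₗ f ∘ₗ e.symm
      invFun := fun f => e'.symm ∘ₗ f ∘ₗ e
      left_inv := fun f => by ext; simp
      right_inv := fun f => by ext; simp
      map_add' := fun f g => by ext; simp
      map_smul' := fun c f => by
        ext x
        exact LinearMap.map_smul_of_tower e'.toLinearMap c (f (e.symm x)) }

section

variable (P Q X : Type*) [AddCommGroup P] [Module K P] [Module A P] [IsScalarTower K A P]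
  [AddCommGroup Q] [Module K Q] [Module A Q] [IsScalarTower K A Q]
  [AddCommGroup X] [Module K X] [Module A X] [IsScalarTower K A X]
  [FiniteDimensional K P] [FiniteDimensional K Q] [FiniteDimensional K X]

instance finiteDimensional_linearMap : FiniteDimensional K (P →ₗ[A] Q) :=
  .of_injective (LinearMap.restrictScalarsₗ K A P Q K) (LinearMap.restrictScalars_injective _)

variable {P} in
theorem finrank_linearMap_le_add_left (N : Submodule A P) :
    finrank K (P →ₗ[A] X) ≤ finrank K (N →ₗ[A] X) + finrank K ((P ⧸ N) →ₗ[A] X) := by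
  let α : ((P ⧸ N) →ₗ[A] X) →ₗ[K] (P →ₗ[A] X) :=
    { toFun := fun f => f ∘ₗ N.mkQ
      map_add' := fun _ _ => rfl
      map_smul' := fun _ _ => rfl }
  let β : (P →ₗ[A] X) →ₗ[K] (N →ₗ[A] X) :=
    { toFun := fun f => f ∘ₗ N.subtype
      map_add' := fun _ _ => rfl
      map_smul' := fun _ _ => rfl }
  refine finrank_le_add_of_ker_le_range (α := α) (β := β) fun f hf => ?_
  refine ⟨N.liftQ f fun x hx => ?_, N.liftQ_mkQ f _⟩
  exact LinearMap.congr_fun (LinearMap.mem_ker.mp hf) ⟨x, hx⟩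

variable {P} in
theorem finrank_linearMap_le_add_right (N : Submodule A P) :
    finrank K (X →ₗ[A] P) ≤ finrank K (X →ₗ[A] (P ⧸ N)) + finrank K (X →ₗ[A] N) := by
  let α : (X →ₗ[A] N) →ₗ[K] (X →ₗ[A] P) :=
    { toFun := fun f => N.subtype ∘ₗ f
      map_add' := fun _ _ => rfl
      map_smul' := fun _ _ => rfl }
  let β : (X →ₗ[A] P) →ₗ[K] (X →ₗ[A] (P ⧸ N)) :=
    { toFun := fun f => N.mkQ ∘ₗ f
      map_add' := fun f g => by ext; simp
      map_smul' := fun c f => by ext; simp }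
  refine finrank_le_add_of_ker_le_range (α := α) (β := β) fun f hf => ?_
  have h (x : X) : f x ∈ N := by
    simpa [β] using LinearMap.congr_fun (LinearMap.mem_ker.mp hf) x
  exact ⟨f.codRestrict N h, rfl⟩

theorem finrank_linearMap_prod_left :
    finrank K ((P × Q) →ₗ[A] X) = finrank K (P →ₗ[A] X) + finrank K (Q →ₗ[A] X) := by
  rw [← (LinearMap.coprodEquiv K (M := P) (M₂ := Q) (M₃ := X) (R := A)).finrank_eq, finrank_prod]

theorem finrank_linearMap_prod_right :
    finrank K (X →ₗ[A] P × Q) = finrank K (X →ₗ[A] P) + finrank K (X →ₗ[A] Q) := by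
  rw [← (LinearMap.prodEquiv K (M := X) (M₂ := P) (M₃ := Q) (R := A)).finrank_eq, finrank_prod]

end

/-- Every finite-dimensional module has a semisimplification: a semisimple module with the same
characteristic polynomials, which moreover dominates it in the dimension of spaces of
homomorphisms. -/
theorem exists_semisimplification (M : Type u) [AddCommGroup M] [Module K M] [Module A M]
    [IsScalarTower K A M] [FiniteDimensional K M] :
    ∃ (U : Type u) (_ : AddCommGroup U) (_ : Module K U) (_ : Module A U)
      (_ : IsScalarTower K A U) (_ : FiniteDimensional K U), IsSemisimpleModule A U ∧
      (∀ a : A, moduleCharpoly K M a = moduleCharpoly K U a) ∧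
      ∀ (X : Type u) [AddCommGroup X] [Module K X] [Module A X] [IsScalarTower K A X]
        [FiniteDimensional K X], finrank K (M →ₗ[A] X) ≤ finrank K (U →ₗ[A] X) ∧
          finrank K (X →ₗ[A] M) ≤ finrank K (X →ₗ[A] U) := by
  induction hn : finrank K M using Nat.strong_induction_on generalizing M with
  | _ n ih =>
  by_cases hM : IsSemisimpleModule A M
  · exact ⟨M, _, _, _, inferInstance, inferInstance, hM, fun _ => rfl, fun X => by simp⟩
  obtain ⟨N, hbot, htop⟩ : ∃ N : Submodule A M, N ≠ ⊥ ∧ N ≠ ⊤ := by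
    by_contra! hN
    refine hM ((isSemisimpleModule_iff A M).mpr ⟨fun N => ?_⟩)
    by_cases h : N = ⊥
    · exact ⟨⊤, h ▸ isCompl_bot_top⟩
    · exact ⟨⊥, hN N h ▸ isCompl_top_bot⟩
  have hadd : finrank K (M ⧸ N) + finrank K N = finrank K M :=
    (N.restrictScalars K).finrank_quotient_add_finrank
  have hNlt := finrank_submodule_lt (K := K) htop
  have hNpos : 0 < finrank K N := by
    have : Nontrivial N := Submodule.nontrivial_iff_ne_bot.mpr hbot
    exact finrank_pos
  obtain ⟨U, _, _, _, _, _, _, hUc, hU⟩ := ih _ (hn ▸ hNlt) N rfl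
  obtain ⟨U', _, _, _, _, _, _, hUc', hU'⟩ := ih _ (by omega) (M ⧸ N) rfl
  refine ⟨U × U', inferInstance, inferInstance, inferInstance, inferInstance, inferInstance,
    isSemisimpleModule_prod, fun a => ?_, fun X => ?_⟩
  · rw [moduleCharpoly_prod, ← hUc, ← hUc']
    exact LinearMap.charpoly_eq_charpoly_mul_charpoly (N.restrictScalars K)
      (Algebra.lsmul K K M a) fun x hx => N.smul_mem a hx
  · intros
    rw [finrank_linearMap_prod_left, finrank_linearMap_prod_right]
    have := finrank_linearMap_le_add_left (K := K) X N
    have := finrank_linearMap_le_add_right (K := K) X N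
    have := hU X
    have := hU' X
    omega

/-- The endomorphism algebra of a module over an algebraically closed field is at most as large as
that of its semisimplification, the latter being characterized by characteristic polynomials. -/
theorem finrank_end_le_of_moduleCharpoly_eq [IsAlgClosed K] {T : Set A} (h1 : 1 ∈ T)
    (hT : Submodule.span K T = ⊤)
    (M N : Type u) [AddCommGroup M] [Module K M] [Module A M] [IsScalarTower K A M]
    [FiniteDimensional K M]
    [AddCommGroup N] [Module K N] [Module A N] [IsScalarTower K A N]
    [FiniteDimensional K N] [IsSemisimpleModule A N]
    (h : ∀ a ∈ T, moduleCharpoly K M a = moduleCharpoly K N a) :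
    finrank K (M →ₗ[A] M) ≤ finrank K (N →ₗ[A] N) := by
  obtain ⟨U, _, _, _, _, _, _, hUc, hU⟩ := exists_semisimplification (K := K) (A := A) M
  obtain ⟨e⟩ := nonempty_linearEquiv_of_moduleCharpoly_eq h1 hT U N fun a ha => by
    rw [← hUc, h a ha]
  calc finrank K (M →ₗ[A] M) ≤ finrank K (U →ₗ[A] M) := (hU M).1
    _ ≤ finrank K (U →ₗ[A] U) := (hU U).2
    _ = finrank K (N →ₗ[A] N) := finrank_linearMap_congr e e

end FiniteDimensionalModules

section BaseChange

open TensorProduct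

variable {F : Type*} [Field F] (K : Type*) [Field K] [Algebra F K] {W : Type*} [AddCommGroup W]
  [Module F W]

theorem tensorProductEnd_tmul (a : K) (f : End F W) :
    LinearMap.tensorProductEnd F K W (a ⊗ₜ f) = a • f.baseChange K :=
  rfl

theorem tensorProductEnd_bijective [FiniteDimensional F W] :
    Function.Bijective (LinearMap.tensorProductEnd F K W) := by
  let e := (TensorProduct.isBaseChange F W K).end.equiv
  have h : (LinearMap.tensorProductEnd F K W).toLinearMap = e.toLinearMap := by
    ext f w
    have h' := (TensorProduct.isBaseChange F W K).endHom_comp_apply f w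
    simp only [TensorProduct.mk_apply] at h'
    simp [e, IsBaseChange.equiv_tmul, h', -LinearMap.tensorProductEnd_apply,
      tensorProductEnd_tmul]
  have h' : ⇑(LinearMap.tensorProductEnd F K W) = e := funext fun x => LinearMap.congr_fun h x
  exact h' ▸ e.bijective

/-- The dimension of a commutant is invariant under extension of scalars. -/
theorem finrank_centralizer_baseChange [FiniteDimensional F W] (S : Set (End F W)) :
    finrank K (Subalgebra.centralizer K (LinearMap.baseChange K '' S)) =
      finrank F (Subalgebra.centralizer F S) := by
  let C := Subalgebra.centralizer F S
  let E := AlgEquiv.ofBijective (LinearMap.tensorProductEnd F K W) (tensorProductEnd_bijective K)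
  have hE (f : End F W) : E (1 ⊗ₜ f) = f.baseChange K := by
    simp [E, -LinearMap.tensorProductEnd_apply, tensorProductEnd_tmul]
  let ι : K ⊗[F] C →ₗ[K] End K (K ⊗[F] W) :=
    E.toLinearMap ∘ₗ C.val.toLinearMap.baseChange K
  have hι : Function.Injective ι :=
    E.injective.comp (Module.Flat.lTensor_preserves_injective_linearMap C.val.toLinearMap
      Subtype.val_injective)
  have hrange : LinearMap.range ι =
      (Subalgebra.centralizer K (LinearMap.baseChange K '' S)).toSubmodule := by
    ext f
    have h := SetLike.ext_iff.mp
      (Subalgebra.centralizer_coe_image_includeRight_eq_center_tensorProduct F K (End F W) S)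
      (E.symm f)
    simp only [Subalgebra.mem_centralizer_iff, Set.forall_mem_image, AlgHom.mem_range] at h
    rw [Subalgebra.mem_toSubmodule, Subalgebra.mem_centralizer_iff, Set.forall_mem_image]
    trans ∃ x, Algebra.TensorProduct.map (AlgHom.id F K) C.val x = E.symm f
    · exact exists_congr fun x => E.eq_symm_apply.symm
    · rw [← h]
      refine forall₂_congr fun g _ => ?_
      rw [← E.injective.eq_iff]
      simp [hE]
  rw [← finrank_baseChange (R := K) (M' := C), ← LinearMap.finrank_range_of_inj hι, hrange]
  rfl

variable {K} {G : Type*} [Group G]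

theorem finrank_end_asModule {V : Type*} [AddCommGroup V] [Module K V]
    (ρ : Representation K G V) :
    finrank K (ρ.asModule →ₗ[MonoidAlgebra K G] ρ.asModule) =
      finrank K (Subalgebra.centralizer K (Set.range ρ)) := by
  let ι : (ρ.asModule →ₗ[MonoidAlgebra K G] ρ.asModule) →ₗ[K] End K V :=
    (ρ.asModuleEquiv.conj).toLinearMap ∘ₗ
      LinearMap.restrictScalarsₗ K (MonoidAlgebra K G) ρ.asModule ρ.asModule K
  have hι : Function.Injective ι :=
    ρ.asModuleEquiv.conj.injective.comp (LinearMap.restrictScalars_injective K)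
  have hrange : LinearMap.range ι = (Subalgebra.centralizer K (Set.range ρ)).toSubmodule := by
    ext f
    rw [Subalgebra.mem_toSubmodule, Subalgebra.mem_centralizer_iff, Set.forall_mem_range]
    constructor
    · rintro ⟨φ, rfl⟩ g
      ext v
      have := φ.map_smul (MonoidAlgebra.single g 1) (ρ.asModuleEquiv.symm v)
      simp only [Representation.single_smul, one_smul] at this
      exact congr(ρ.asModuleEquiv $this).symm
    · intro h
      refine ⟨{ toFun := fun v => ρ.asModuleEquiv.symm (f (ρ.asModuleEquiv v))
                map_add' := fun v w => by simp
                map_smul' := fun a v => ?_ }, by ext; simp [ι]⟩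
      induction a using MonoidAlgebra.induction_on with
      | of g =>
        have := LinearMap.congr_fun (h g) (ρ.asModuleEquiv v)
        simp only [MonoidAlgebra.of_apply, Representation.single_smul, one_smul, RingHom.id_apply]
        exact this.symm
      | add a b ha hb => simp_all [add_smul]
      | smul r a ha =>
        simp only [RingHom.id_apply] at ha ⊢
        rw [smul_assoc, smul_assoc, map_smul, map_smul, map_smul, ha]
  rw [← LinearMap.finrank_range_of_inj hι, hrange]
  rfl

variable (K) in
/-- Extension of scalars of a representation. -/
noncomputable def baseChangeRepresentation (ρ : Representation F G W) :
    Representation K G (K ⊗[F] W) :=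
  (Module.End.baseChangeHom F K W : End F W →* End K (K ⊗[F] W)).comp ρ

@[simp]
theorem baseChangeRepresentation_apply (ρ : Representation F G W) (g : G) :
    baseChangeRepresentation K ρ g = (ρ g).baseChange K :=
  rfl

variable (K) in
theorem finrank_end_baseChangeRepresentation [FiniteDimensional F W] (ρ : Representation F G W) :
    finrank K ((baseChangeRepresentation K ρ).asModule →ₗ[MonoidAlgebra K G]
      (baseChangeRepresentation K ρ).asModule) =
      finrank F (Subalgebra.centralizer F (Set.range ρ)) := by
  rw [finrank_end_asModule, ← finrank_centralizer_baseChange K (Set.range ρ), ← Set.range_comp]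
  rfl

end BaseChange

section GaloisDescent

open TensorProduct

variable {F K : Type*} [Field F] [Field K] [Algebra F K] {W : Type*} [AddCommGroup W]
  [Module F W]

variable (W) in
/-- The action of a field automorphism on an extension of scalars. -/
noncomputable def galoisTwist (σ : K ≃ₐ[F] K) : K ⊗[F] W ≃ₗ[F] K ⊗[F] W :=
  TensorProduct.congr σ.toLinearEquiv (.refl F W)

@[simp]
theorem galoisTwist_tmul (σ : K ≃ₐ[F] K) (c : K) (w : W) :
    galoisTwist W σ (c ⊗ₜ w) = σ c ⊗ₜ w :=
  rfl

theorem galoisTwist_smul (σ : K ≃ₐ[F] K) (c : K) (x : K ⊗[F] W) :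
    galoisTwist W σ (c • x) = σ c • galoisTwist W σ x := by
  induction x with
  | zero => simp
  | tmul d w => simp [smul_tmul']
  | add x y hx hy => simp [hx, hy]

theorem galoisTwist_baseChange (σ : K ≃ₐ[F] K) (f : End F W) (x : K ⊗[F] W) :
    galoisTwist W σ (f.baseChange K x) = f.baseChange K (galoisTwist W σ x) := by
  induction x with
  | zero => simp
  | tmul d w => simp
  | add x y hx hy => simp [hx, hy]

theorem repr_galoisTwist {ι : Type*} (b : Basis ι F W) (σ : K ≃ₐ[F] K) (x : K ⊗[F] W) (i : ι) :
    (b.baseChange K).repr (galoisTwist W σ x) i = σ ((b.baseChange K).repr x i) := by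
  induction x with
  | zero => simp
  | tmul d w => simp
  | add x y hx hy => simp [hx, hy]

/-- A nonzero subspace of an extension of scalars that is stable under the Galois group contains a
nonzero rational vector. -/
theorem exists_one_tmul_mem_of_galoisTwist_mem [IsGalois F K] {N : Submodule K (K ⊗[F] W)}
    (hN : ∀ (σ : K ≃ₐ[F] K), ∀ x ∈ N, galoisTwist W σ x ∈ N) (h : N ≠ ⊥) :
    ∃ w : W, w ≠ 0 ∧ (1 : K) ⊗ₜ[F] w ∈ N := by
  let b := Basis.ofVectorSpace F W
  let B := b.baseChange K
  obtain ⟨y, ⟨hyN, hy⟩, hmin⟩ := exists_minimalFor_of_wellFoundedLT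
    (fun x => x ∈ N ∧ x ≠ 0) (fun x => (B.repr x).support.card) (N.ne_bot_iff.mp h)
  obtain ⟨i, hi⟩ := Finsupp.ne_iff.mp (B.repr.map_ne_zero_iff.mpr hy)
  rw [Finsupp.zero_apply] at hi
  let x := (B.repr y i)⁻¹ • y
  have hxN : x ∈ N := N.smul_mem _ hyN
  have hx : x ≠ 0 := smul_ne_zero (inv_ne_zero hi) hy
  have hfix (σ : K ≃ₐ[F] K) : galoisTwist W σ x = x := by
    by_contra hσ
    have hlt : (B.repr (galoisTwist W σ x - x)).support.card < (B.repr y).support.card := by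
      refine Finset.card_lt_card ⟨fun j hj => ?_, fun hsub => ?_⟩
      · contrapose! hj
        simp only [Finsupp.mem_support_iff, not_not] at hj ⊢
        simp [B, repr_galoisTwist, x, show (b.baseChange K).repr y j = 0 from hj]
      · have := hsub (Finsupp.mem_support_iff.mpr hi)
        refine Finsupp.mem_support_iff.mp this ?_
        have hxi : (b.baseChange K).repr x i = 1 := by
          simpa [x] using inv_mul_cancel₀ hi
        simp [B, repr_galoisTwist, hxi]
    have := hmin ⟨N.sub_mem (hN σ x hxN) hxN, sub_ne_zero.mpr hσ⟩ hlt.le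
    exact absurd hlt this.not_gt
  have hcoord (j) : ∃ c : F, algebraMap F K c = B.repr x j :=
    (InfiniteGalois.mem_range_algebraMap_iff_fixed _).mpr fun σ => by
      rw [← repr_galoisTwist, hfix]
  choose c hc using hcoord
  have hxw : x = (1 : K) ⊗ₜ[F] ((B.repr x).sum fun j _ => c j • b j) := by
    conv_lhs => rw [← B.linearCombination_repr x]
    rw [Finsupp.linearCombination_apply, Finsupp.sum, Finsupp.sum, tmul_sum]
    refine Finset.sum_congr rfl fun j _ => ?_
    rw [← hc, Basis.baseChange_apply, algebraMap_smul, tmul_smul]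
  refine ⟨_, fun hw => hx ?_, hxw ▸ hxN⟩
  rw [hxw, hw, tmul_zero]

variable {G : Type*} [Group G] (ρ : Representation F G W)

/-- A field automorphism permutes the subrepresentations of an extension of scalars. -/
theorem exists_orderIso_galoisTwist_mem (σ : K ≃ₐ[F] K) :
    ∃ e : Submodule (MonoidAlgebra K G) (baseChangeRepresentation K ρ).asModule ≃o
      Submodule (MonoidAlgebra K G) (baseChangeRepresentation K ρ).asModule,
      ∀ N, ∀ x ∈ N, (baseChangeRepresentation K ρ).asModuleEquiv.symm
        (galoisTwist W σ ((baseChangeRepresentation K ρ).asModuleEquiv x)) ∈ e N := by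
  let φ := MonoidAlgebra.mapRingEquiv G σ.toRingEquiv
  let M := (baseChangeRepresentation K ρ).asModule
  have : RingHomInvPair (φ : MonoidAlgebra K G →+* MonoidAlgebra K G) φ.symm :=
    .of_ringEquiv φ
  have : RingHomInvPair (φ.symm : MonoidAlgebra K G →+* MonoidAlgebra K G) φ :=
    .symm _ _
  let τ : M ≃+ M := (galoisTwist W σ).toAddEquiv
  have hτ (a : MonoidAlgebra K G) (x : M) : τ (a • x) = φ a • τ x := by
    induction a using MonoidAlgebra.induction_linear with
    | zero => simp
    | add a b ha hb => simp [add_smul, ha, hb]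
    | single g c =>
      have hφ : φ (.single g c) = .single g (σ c) := by simp [φ]
      rw [hφ, Representation.single_smul, Representation.single_smul]
      exact (galoisTwist_smul σ c _).trans (congrArg _ (galoisTwist_baseChange σ (ρ g) x))
  let τ' : M ≃ₛₗ[(φ : MonoidAlgebra K G →+* MonoidAlgebra K G)] M :=
    { τ with map_smul' := hτ }
  exact ⟨Submodule.orderIsoMapComap τ', fun N x hx => Submodule.mem_map_of_mem hx⟩

theorem isSemisimpleModule_asModule_of_sSup_isAtom {V : Type*} [AddCommGroup V] [Module K V]
    (ρ : Representation K G V)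
    (h : sSup {m : Submodule (MonoidAlgebra K G) ρ.asModule | IsAtom m} = ⊤) :
    IsSemisimpleModule (MonoidAlgebra K G) ρ.asModule :=
  .of_sSup_simples_eq_top (by simpa only [isSimpleModule_iff_isAtom] using h)

theorem isAtomic_submodule_asModule {V : Type*} [AddCommGroup V] [Module K V]
    [FiniteDimensional K V] (ρ : Representation K G V) :
    IsAtomic (Submodule (MonoidAlgebra K G) ρ.asModule) :=
  have : IsArtinian (MonoidAlgebra K G) ρ.asModule := isArtinian_of_tower K inferInstance
  isAtomic_of_orderBot_wellFounded_lt wellFounded_lt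

/-- Over a Galois extension, extension of scalars preserves semisimplicity of finite-dimensional
representations. -/
theorem isSemisimpleModule_baseChangeRepresentation [IsGalois F K] [FiniteDimensional F W]
    (hρ : ∀ U : Submodule F W, (∀ g, ∀ x ∈ U, ρ g x ∈ U) →
      ∃ U' : Submodule F W, (∀ g, ∀ x ∈ U', ρ g x ∈ U') ∧ IsCompl U U') :
    IsSemisimpleModule (MonoidAlgebra K G) (baseChangeRepresentation K ρ).asModule := by
  let N : Submodule (MonoidAlgebra K G) (baseChangeRepresentation K ρ).asModule :=
    sSup {m | IsAtom m}
  let N' : Submodule K (K ⊗[F] W) := N.restrictScalars K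
  have hNσ (σ : K ≃ₐ[F] K) (x : K ⊗[F] W) (hx : x ∈ N') : galoisTwist W σ x ∈ N' := by
    obtain ⟨e, he⟩ := exists_orderIso_galoisTwist_mem ρ σ
    have : e N = N := by
      simp only [N, e.map_sSup]
      refine le_antisymm (iSup₂_le fun m hm => le_sSup ((e.isAtom_iff m).mpr hm))
        (sSup_le fun m hm => ?_)
      exact le_iSup₂_of_le (e.symm m) ((e.symm.isAtom_iff m).mpr hm) (by simp)
    exact this.le (he N x hx)
  have hNg (g : G) (x : K ⊗[F] W) (hx : x ∈ N') : baseChangeRepresentation K ρ g x ∈ N' := by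
    have := N.smul_mem (MonoidAlgebra.single g 1) hx
    rw [Representation.single_smul (baseChangeRepresentation K ρ) 1 g x, one_smul] at this
    exact this
  have hUg (g : G) (x : W) (hx : (1 : K) ⊗ₜ[F] x ∈ N') : (1 : K) ⊗ₜ[F] ρ g x ∈ N' := hNg g _ hx
  let U : Submodule F W := (N'.restrictScalars F).comap (TensorProduct.mk F K W 1)
  obtain ⟨U', hU', hc⟩ := hρ U hUg
  let π : End F W := U.subtype ∘ₗ U.projectionOnto U' hc
  have hπ (w : W) : π w = 0 ↔ w ∈ U' := by
    simp [π]
  have hπU (w : W) (hw : w ∈ U) : π w = w := by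
    simp [π, Submodule.projectionOnto_apply_left hc ⟨w, hw⟩]
  have hπρ (g : G) : π ∘ₗ ρ g = ρ g ∘ₗ π := by
    ext w
    obtain ⟨u, hu, u', hu', rfl⟩ := Submodule.mem_sup.mp
      (hc.sup_eq_top ▸ Submodule.mem_top : w ∈ U ⊔ U')
    simp [hπU u hu, (hπ u').mpr hu', hπU _ (hUg g u hu), (hπ _).mpr (hU' g u' hu')]
  have hQg (g : G) (x : K ⊗[F] W) (hx : π.baseChange K x = 0) :
      π.baseChange K ((ρ g).baseChange K x) = 0 := by
    rw [← LinearMap.comp_apply, ← LinearMap.baseChange_comp, hπρ, LinearMap.baseChange_comp,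
      LinearMap.comp_apply, hx, map_zero]
  let Q' : Submodule K (K ⊗[F] W) := LinearMap.ker (π.baseChange K)
  let Q : Submodule (MonoidAlgebra K G) (baseChangeRepresentation K ρ).asModule :=
    { Q' with
      smul_mem' := fun a x hx => by
        induction a using MonoidAlgebra.induction_linear with
        | zero => exact (zero_smul (MonoidAlgebra K G) x).symm ▸ Q'.zero_mem
        | add a b ha hb =>
          rw [add_smul]
          exact Q'.add_mem ha hb
        | single g c =>
          rw [Representation.single_smul]
          exact Q'.smul_mem c (hQg g x hx) }
  have hdisj : N' ⊓ Q' = ⊥ := by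
    by_contra h
    obtain ⟨w, hw, hwN, hwQ⟩ := exists_one_tmul_mem_of_galoisTwist_mem (N := N' ⊓ Q')
      (fun σ x hx => ⟨hNσ σ x hx.1, by
        change π.baseChange K (galoisTwist W σ x) = 0
        rw [← galoisTwist_baseChange, show π.baseChange K x = 0 from hx.2, map_zero]⟩) h
    have hwQ : (1 : K) ⊗ₜ[F] π w = 0 := hwQ
    have hw' : w ∈ U' := (hπ w).mp (by simpa using hwQ)
    exact hw ((Submodule.disjoint_def.mp hc.disjoint) w hwN hw')
  have := isAtomic_submodule_asModule (baseChangeRepresentation K ρ)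
  have hQ : Q = ⊥ := by
    refine (eq_bot_or_exists_atom_le Q).resolve_right ?_
    rintro ⟨m, hm, hmQ⟩
    refine hm.1 (eq_bot_iff.mpr fun x hx => ?_)
    have : x ∈ N' ⊓ Q' := ⟨(le_sSup hm : m ≤ N) hx, hmQ hx⟩
    rw [hdisj] at this
    exact this
  have hU : U = ⊤ := by
    have : U' = ⊥ := by
      refine eq_bot_iff.mpr fun w hw => ?_
      have hwQ : (1 : K) ⊗ₜ[F] w ∈ Q := by
        change (1 : K) ⊗ₜ[F] π w = 0
        rw [(hπ w).mpr hw, tmul_zero]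
      rw [hQ] at hwQ
      have : (1 : K) ⊗ₜ[F] w = 0 := hwQ
      simpa using this
    simpa [this] using hc.sup_eq_top
  refine isSemisimpleModule_asModule_of_sSup_isAtom _ (eq_top_iff.mpr fun x _ => ?_)
  have hmem (y : K ⊗[F] W) : y ∈ N' := by
    induction y with
    | zero => exact N'.zero_mem
    | tmul c w =>
      have hw : w ∈ U := hU ▸ Submodule.mem_top
      have := N'.smul_mem c hw
      simpa [smul_tmul'] using this
    | add x y hx hy => exact N'.add_mem hx hy
  exact hmem x

end GaloisDescent

theorem span_range_monoidAlgebra_of (K G : Type*) [Field K] [Group G] :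
    Submodule.span K (Set.range (MonoidAlgebra.of K G)) = ⊤ := by
  refine eq_top_iff.mpr fun a _ => ?_
  induction a using MonoidAlgebra.induction_on with
  | of g => exact Submodule.subset_span ⟨g, rfl⟩
  | add a b ha hb => exact add_mem (ha trivial) (hb trivial)
  | smul r a ha => exact Submodule.smul_mem _ r (ha trivial)

theorem moduleCharpoly_asModule_of {K G V : Type*} [Field K] [Group G] [AddCommGroup V]
    [Module K V] [FiniteDimensional K V] (ρ : Representation K G V) (g : G) :
    moduleCharpoly K ρ.asModule (MonoidAlgebra.of K G g) = (ρ g).charpoly := by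
  have : Algebra.lsmul K K ρ.asModule (MonoidAlgebra.of K G g) =
      ρ.asModuleEquiv.symm.conj (ρ g) := by
    ext x
    simp only [Algebra.lsmul_coe, MonoidAlgebra.of_apply, Representation.single_smul, one_smul]
    rfl
  rw [moduleCharpoly, this, LinearEquiv.charpoly_conj]

/-- The dimension of the commutant of a finite-dimensional representation over a perfect field is
at most that of its semisimplification. -/
theorem finrank_centralizer_le_of_charpoly_eq {G : Type*} {F V W : Type u} [Field F]
    [PerfectField F] [Group G] [AddCommGroup V] [Module F V] [FiniteDimensional F V]
    [AddCommGroup W] [Module F W] [FiniteDimensional F W]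
    (ρ : Representation F G V) (τ : Representation F G W)
    (hτ : ∀ U : Submodule F W, (∀ g, ∀ x ∈ U, τ g x ∈ U) →
      ∃ U' : Submodule F W, (∀ g, ∀ x ∈ U', τ g x ∈ U') ∧ IsCompl U U')
    (h : ∀ g, (ρ g).charpoly = (τ g).charpoly) :
    finrank F (Subalgebra.centralizer F (Set.range ρ)) ≤
      finrank F (Subalgebra.centralizer F (Set.range τ)) := by
  let K := AlgebraicClosure F
  have := isSemisimpleModule_baseChangeRepresentation (K := K) τ hτ
  rw [← finrank_end_baseChangeRepresentation K ρ, ← finrank_end_baseChangeRepresentation K τ]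
  refine finrank_end_le_of_moduleCharpoly_eq (T := Set.range (MonoidAlgebra.of K G)) ⟨1, map_one _⟩
    (span_range_monoidAlgebra_of K G) (baseChangeRepresentation K ρ).asModule
    (baseChangeRepresentation K τ).asModule ?_
  rintro _ ⟨g, rfl⟩
  rw [moduleCharpoly_asModule_of, moduleCharpoly_asModule_of, baseChangeRepresentation_apply,
    baseChangeRepresentation_apply, LinearMap.charpoly_baseChange, LinearMap.charpoly_baseChange, h]

/-- `F` a perfect field, `V` a finite-dimensional `F`-vector space,
`G ⊆ GL(V)` a subgroup, `Vss` the semisimplification of `V` as a `G`-representation, with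
`G` acting on `Vss` through `ρ` (so that `ρ(G) = G^red` is the image of `G` in `GL(Vss)`).
The semisimplification is characterized (Brauer–Nesbitt) by: `Vss` is a semisimple
representation of `G` and every `g ∈ G` has the same characteristic polynomial on `V` and
on `Vss`.  Then `dim_F End_G(V) ≤ dim_F End_{G^red}(Vss)`. -/
theorem stmt_3 (F V Vss : Type) [Field F] [PerfectField F]
    [AddCommGroup V] [Module F V] [FiniteDimensional F V]
    [AddCommGroup Vss] [Module F Vss] [FiniteDimensional F Vss]
    (G : Subgroup (V ≃ₗ[F] V)) (ρ : G →* (Vss ≃ₗ[F] Vss))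
    (hss : ActsSemisimply (Set.range fun g : G => ρ g))
    (hchar : ∀ g : G,
      LinearMap.charpoly ((g : V ≃ₗ[F] V) : Module.End F V) =
      LinearMap.charpoly ((ρ g : Vss ≃ₗ[F] Vss) : Module.End F Vss)) :
    commutantDim (G : Set (V ≃ₗ[F] V)) ≤ commutantDim (Set.range fun g : G => ρ g) := by
  let ρV : Representation F G V :=
    (LinearEquiv.automorphismGroup.toLinearMapMonoidHom (R := F) (M := V)).comp G.subtype
  let ρW : Representation F G Vss :=
    (LinearEquiv.automorphismGroup.toLinearMapMonoidHom (R := F) (M := Vss)).comp ρ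
  have hV : (fun g : V ≃ₗ[F] V => (g : Module.End F V)) '' G = Set.range ρV := by
    rw [← Subtype.range_coe (s := (G : Set (V ≃ₗ[F] V))), ← Set.range_comp]
    rfl
  have hW : (fun g : Vss ≃ₗ[F] Vss => (g : Module.End F Vss)) '' (Set.range fun g : G => ρ g) =
      Set.range ρW := by
    rw [← Set.range_comp]
    rfl
  unfold commutantDim
  rw [hV, hW]
  refine finrank_centralizer_le_of_charpoly_eq ρV ρW (fun U hU => ?_) hchar
  obtain ⟨U', hU', hc⟩ := hss U (Set.forall_mem_range.mpr hU)
  exact ⟨U', fun g => hU' _ ⟨g, rfl⟩, hc⟩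
end

section
/- Let $F$ be a perfect field, $V$ a finite-dimensional $F$-vector space, $G \subseteq \mathrm{GL}(V)$ a subgroup, $V^{ss}$ the semisimplification of $V$ as a $G$-representation, and $G^{red}$ the image of $G$ in $\mathrm{GL}(V^{ss})$. If $\dim_F \mathrm{End}_G(V) \geq \dim_F \mathrm{End}_{G^{red}}(V^{ss})$, then $V$ is a semisimple $G$-representation. -/
open Module

section Amitsur

open Polynomial

variable {F A n : Type*} [Field F] [Fintype n] [DecidableEq n]

/-- The multiplicative map `A[X] → F[X]` obtained by applying a matrix representation of `A`
coefficientwise and taking the determinant. -/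
noncomputable def polyDet [Ring A] (φ : A →+* Matrix n n F) : A[X] →* F[X] :=
  (Matrix.detMonoidHom.comp (matPolyEquiv (R := F) (n := n)).symm.toRingEquiv.toMonoidHom).comp
    (mapRingHom φ).toMonoidHom

theorem polyDet_apply [Ring A] (φ : A →+* Matrix n n F) (u : A[X]) :
    polyDet φ u = (matPolyEquiv.symm (u.map φ)).det := rfl

theorem X_pow_dvd_polyDet_sub_one [Ring A] (φ : A →+* Matrix n n F) (N : ℕ) (v : A[X]) :
    X ^ N ∣ polyDet φ (1 + X ^ N * v) - 1 := by
  have h : matPolyEquiv.symm ((1 + X ^ N * v).map φ) =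
      1 + (X ^ N : F[X]) • matPolyEquiv.symm (v.map φ) := by
    apply matPolyEquiv.injective
    rw [map_add, matPolyEquiv_map_smul]
    simp
  rw [polyDet_apply, h, Matrix.det_one_add_smul]
  rw [add_assoc, add_sub_cancel_left, pow_two, ← mul_assoc, ← add_mul]
  exact dvd_mul_left _ _

theorem polyDet_one_sub_X_pow_mul_C [Ring A] [Algebra F A] (φ : A →ₐ[F] Matrix n n F) (k : ℕ)
    (c : F) (a : A) :
    polyDet (φ : A →+* Matrix n n F) (1 - X ^ k * C (c • a)) =
      (φ a).charpolyRev.comp (C c * X ^ k) := by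
  have h : matPolyEquiv.symm ((1 - X ^ k * C (c • a)).map (φ : A →+* Matrix n n F)) =
      (compRingHom (C c * X ^ k)).mapMatrix (1 - (X : F[X]) • (φ a).map C) := by
    apply matPolyEquiv.injective
    have : (compRingHom (C c * X ^ k)).mapMatrix (1 - (X : F[X]) • (φ a).map C) =
        1 - (C c * X ^ k : F[X]) • (φ a).map C := by
      rw [map_sub, map_one]
      congr 1
      ext1 i j
      simp only [RingHom.mapMatrix_apply, Matrix.map_apply, Matrix.smul_apply, smul_eq_mul,
        coe_compRingHom_apply, mul_comp, X_comp, C_comp]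
    rw [this, map_sub, matPolyEquiv_map_smul]
    simp only [Polynomial.map_sub, Polynomial.map_one, Polynomial.map_mul, Polynomial.map_pow,
      map_X, map_C, AlgEquiv.apply_symm_apply, map_one, matPolyEquiv_map_C, RingHom.coe_coe,
      map_smul]
    rw [X_pow_mul, Algebra.smul_def, C_mul, mul_assoc, ← X_pow_mul, ← mul_assoc]
  rw [polyDet_apply, h, Matrix.charpolyRev, ← RingHom.map_det, coe_compRingHom_apply]

theorem X_pow_dvd_polyDet_sub_polyDet [Ring A] [Algebra F A] (φ ψ : A →ₐ[F] Matrix n n F)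
    {S : Set A} (hS : Submodule.span F S = ⊤)
    (h : ∀ g ∈ S, (φ g).charpolyRev = (ψ g).charpolyRev) (N j k : ℕ)
    (hk : k + 1 + j = N) (v : A[X]) :
    X ^ N ∣ polyDet (φ : A →+* Matrix n n F) (1 + X ^ (k + 1) * v) -
      polyDet (ψ : A →+* Matrix n n F) (1 + X ^ (k + 1) * v) := by
  induction j generalizing k v with
  | zero =>
    obtain rfl : N = k + 1 := by omega
    simpa using dvd_sub (X_pow_dvd_polyDet_sub_one (φ : A →+* Matrix n n F) _ v)
      (X_pow_dvd_polyDet_sub_one (ψ : A →+* Matrix n n F) _ v)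
  | succ j ih =>
    let Q (a : A) : Prop := ∀ v : A[X],
      X ^ N ∣ polyDet (φ : A →+* Matrix n n F) (1 + X ^ (k + 1) * (C a + X * v)) -
        polyDet (ψ : A →+* Matrix n n F) (1 + X ^ (k + 1) * (C a + X * v))
    have hQ0 : Q 0 := by
      intro v
      have := ih (k + 1) (by omega) v
      rw [pow_succ, mul_assoc] at this
      rwa [C_0, zero_add]
    have hQ (a : A) : ∀ (c : F) (b : A), Q b → Q (c • a + b) := by
      have ha : a ∈ Submodule.span F S := hS ▸ Submodule.mem_top
      induction ha using Submodule.span_induction with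
      | zero => simp
      | add x y _ _ hx hy =>
        intro c b hb
        rw [smul_add, add_assoc]
        exact hx c _ (hy c b hb)
      | smul d x _ hx =>
        intro c b hb
        rw [smul_smul]
        exact hx _ b hb
      | mem g hg =>
        intro c b hb v
        set e : A[X] := C (c • g) with he
        set w : A[X] := C (c • g + b) + X * v with hw
        have hmul : (1 + X ^ (k + 1) * w) * (1 - X ^ (k + 1) * e) =
            1 + X ^ (k + 1) * (C b + X * (v - X ^ k * (w * e))) := by
          have h1 : w * X ^ (k + 1) = X ^ (k + 1) * w := X_pow_mul.symm
          have h2 : w = e + C b + X * v := by rw [hw, he, C_add]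
          calc _ = 1 + X ^ (k + 1) * w - X ^ (k + 1) * e - X ^ (k + 1) * (w * X ^ (k + 1)) * e := by
                noncomm_ring
            _ = 1 + X ^ (k + 1) * (w - e - X ^ (k + 1) * (w * e)) := by
                rw [h1]
                noncomm_ring
            _ = _ := by
                congr 2
                rw [mul_sub, ← mul_assoc X, ← pow_succ']
                generalize X ^ (k + 1) * (w * e) = z
                rw [h2]
                abel
        have hdiff := hb (v - X ^ k * (w * e))
        rw [← hmul, map_mul, map_mul, he, polyDet_one_sub_X_pow_mul_C,
          polyDet_one_sub_X_pow_mul_C, h g hg, ← sub_mul] at hdiff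
        refine IsCoprime.dvd_of_dvd_mul_right (IsCoprime.pow_left ?_) hdiff
        refine (irreducible_X.coprime_iff_not_dvd).2 fun hX ↦ ?_
        rw [X_dvd_iff, coeff_zero_eq_eval_zero, eval_comp] at hX
        simp at hX
    have := hQ (v.coeff 0) 1 0 hQ0 v.divX
    rwa [one_smul, add_zero, add_comm (C _), X_mul_divX_add] at this

/-- Two matrix representations of an algebra which have the same characteristic polynomials on a
spanning set have the same characteristic polynomials everywhere. -/
theorem Matrix.charpoly_eq_of_span_eq_top [Ring A] [Algebra F A] (φ ψ : A →ₐ[F] Matrix n n F)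
    {S : Set A} (hS : Submodule.span F S = ⊤)
    (h : ∀ g ∈ S, (φ g).charpoly = (ψ g).charpoly) (a : A) :
    (φ a).charpoly = (ψ a).charpoly := by
  have hrev : (φ a).charpolyRev = (ψ a).charpolyRev := by
    have key (N : ℕ) : X ^ N ∣ (φ a).charpolyRev - (ψ a).charpolyRev := by
      cases N with
      | zero => simp
      | succ N =>
        have := X_pow_dvd_polyDet_sub_polyDet φ ψ hS
          (fun g hg ↦ by rw [← Matrix.reverse_charpoly, h g hg, Matrix.reverse_charpoly]) (N + 1) N 0
          (by omega) (- C a)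
        have e : (1 + X ^ (0 + 1) * -C a : A[X]) = 1 - X ^ 1 * C ((1 : F) • a) := by
          rw [one_smul, mul_neg, sub_eq_add_neg]
        rw [e, polyDet_one_sub_X_pow_mul_C, polyDet_one_sub_X_pow_mul_C] at this
        simpa using this
    by_contra hne
    have := natDegree_le_of_dvd (key (((φ a).charpolyRev - (ψ a).charpolyRev).natDegree + 1))
      (sub_ne_zero.2 hne)
    simp at this
  rw [← Matrix.reverse_charpoly, ← Matrix.reverse_charpoly, reverse, reverse,
    Matrix.charpoly_natDegree_eq_dim, Matrix.charpoly_natDegree_eq_dim] at hrev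
  simpa using congrArg (reflect (Fintype.card n)) hrev

end Amitsur

section CharpolyExact

open Module.Basis in
theorem LinearMap.charpoly_eq_restrict_mul_mapQ {K V : Type*} [Field K] [AddCommGroup V]
    [Module K V] [FiniteDimensional K V] (W : Submodule K V) (e : V →ₗ[K] V)
    (he : W ≤ W.comap e) :
    e.charpoly = (e.restrict he).charpoly * (W.mapQ W e he).charpoly := by
  let bW := Module.Free.chooseBasis K W
  let bQ := Module.Free.chooseBasis K (V ⧸ W)
  let b := sumQuot bW bQ
  suffices LinearMap.toMatrix b b e =
      Matrix.fromBlocks (LinearMap.toMatrix bW bW (e.restrict he))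
        (Matrix.of fun i l ↦ b.repr (e (b (Sum.inr l))) (Sum.inl i)) 0
        (LinearMap.toMatrix bQ bQ (W.mapQ W e he)) by
    rw [← LinearMap.charpoly_toMatrix e b, this, ← LinearMap.charpoly_toMatrix _ bW,
      ← LinearMap.charpoly_toMatrix _ bQ, Matrix.charpoly_fromBlocks_zero₂₁]
  ext u v
  cases u with
  | inl i =>
    cases v with
    | inl k =>
      simp only [b, sumQuot_inl, Matrix.fromBlocks_apply₁₁, LinearMap.toMatrix_apply]
      apply sumQuot_repr_inl_of_mem
    | inr l => simp [b, LinearMap.toMatrix_apply, Matrix.fromBlocks_apply₁₂]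
  | inr j =>
    cases v with
    | inl k =>
      suffices W.mkQ (e (bW k)) = 0 by simp [LinearMap.toMatrix_apply, b, this]
      rw [← LinearMap.mem_ker, Submodule.ker_mkQ]
      exact he (Submodule.coe_mem (bW k))
    | inr l =>
      simp only [LinearMap.toMatrix_apply, sumQuot_repr_inr, Matrix.fromBlocks_apply₂₂, b]
      rw [← sumQuot_inr bW bQ l, W.mapQ_apply]
      simp

theorem IsSemisimpleModule.prod {A M N : Type*} [Ring A] [AddCommGroup M] [Module A M]
    [AddCommGroup N] [Module A N] [IsSemisimpleModule A M] [IsSemisimpleModule A N] :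
    IsSemisimpleModule A (M × N) := by
  have h : IsSemisimpleModule A
      ↥(LinearMap.range (LinearMap.inl A M N) ⊔ LinearMap.range (LinearMap.inr A M N)) :=
    .sup (.range _) (.range _)
  rw [LinearMap.sup_range_inl_inr] at h
  exact .congr Submodule.topEquiv.symm

theorem exists_smul_eq_self_and_smul_eq_zero (F : Type*) {A M N : Type*} [Field F] [Ring A]
    [Algebra F A] [AddCommGroup M] [Module F M] [Module A M] [IsScalarTower F A M]
    [FiniteDimensional F M] [AddCommGroup N] [Module F N] [Module A N] [IsScalarTower F A N]
    [FiniteDimensional F N] [IsSemisimpleModule A M] [IsSemisimpleModule A N]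
    (hMN : ∀ f : M →ₗ[A] N, f = 0) (hNM : ∀ f : N →ₗ[A] M, f = 0) :
    ∃ a : A, (∀ x : M, a • x = x) ∧ ∀ y : N, a • y = 0 := by
  let p : Module.End (Module.End A (M × N)) (M × N) :=
    { toFun := fun z ↦ (z.1, 0)
      map_add' := fun z w ↦ by simp
      map_smul' := fun f z ↦ by
        have h₁ : (f (0, z.2)).1 = 0 :=
          LinearMap.congr_fun (hNM (LinearMap.fst A M N ∘ₗ f ∘ₗ LinearMap.inr A M N)) z.2
        have h₂ : (f (z.1, 0)).2 = 0 :=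
          LinearMap.congr_fun (hMN (LinearMap.snd A M N ∘ₗ f ∘ₗ LinearMap.inl A M N)) z.1
        have h₃ : f z = f (z.1, 0) + f (0, z.2) := by rw [← map_add]; simp
        simp [h₃, Prod.ext_iff, h₁, h₂] }
  obtain ⟨s, hs⟩ := Module.Finite.fg_top (R := F) (M := M × N)
  have := IsSemisimpleModule.prod (A := A) (M := M) (N := N)
  obtain ⟨a, ha⟩ := jacobson_density (R := A) p s
  have key (z : M × N) : a • z = (z.1, 0) := by
    have hz : z ∈ Submodule.span F (s : Set (M × N)) := hs ▸ Submodule.mem_top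
    induction hz using Submodule.span_induction with
    | mem z hz => exact (ha z hz).symm
    | zero => rw [smul_zero]; rfl
    | add z w _ _ hz hw => rw [smul_add, hz, hw]; simp
    | smul c z _ hz => rw [smul_comm, hz]; simp
  exact ⟨a, fun x ↦ congrArg Prod.fst (key (x, 0)), fun y ↦ congrArg Prod.snd (key (0, y))⟩

variable (F : Type*) {A : Type*} [Field F] [Ring A] [Algebra F A]

/-- The characteristic polynomial of the action of an element of an algebra on a module. -/
noncomputable def actionCharpoly (M : Type*) [AddCommGroup M] [Module F M] [Module A M]
    [IsScalarTower F A M] [FiniteDimensional F M] (a : A) : Polynomial F :=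
  (Algebra.lsmul F F M a).charpoly

variable {M N : Type*} [AddCommGroup M] [Module F M] [Module A M]
    [IsScalarTower F A M] [FiniteDimensional F M] [AddCommGroup N] [Module F N] [Module A N]
    [IsScalarTower F A N] [FiniteDimensional F N]

instance (U : Submodule A M) : FiniteDimensional F U :=
  inferInstanceAs (FiniteDimensional F (U.restrictScalars F))

instance (U : Submodule A M) : FiniteDimensional F (M ⧸ U) :=
  Module.Finite.of_surjective (U.mkQ.restrictScalars F) U.mkQ_surjective

instance : FiniteDimensional F (M →ₗ[A] N) :=
  Module.Finite.of_injective (LinearMap.restrictScalarsₗ F A M N F)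
    (LinearMap.restrictScalars_injective F)

theorem natDegree_actionCharpoly (a : A) : (actionCharpoly F M a).natDegree = finrank F M :=
  LinearMap.charpoly_natDegree _

theorem actionCharpoly_congr (e : M ≃ₗ[A] N) (a : A) :
    actionCharpoly F M a = actionCharpoly F N a := by
  rw [actionCharpoly, actionCharpoly, ← (e.restrictScalars F).charpoly_conj]
  congr 1
  ext x
  simp [LinearEquiv.conj_apply]

theorem actionCharpoly_prod (a : A) :
    actionCharpoly F (M × N) a = actionCharpoly F M a * actionCharpoly F N a := by
  rw [actionCharpoly, actionCharpoly, actionCharpoly, ← LinearMap.charpoly_prodMap]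
  rfl

theorem actionCharpoly_submodule_prod_quotient (U : Submodule A M) (a : A) :
    actionCharpoly F (U × (M ⧸ U)) a = actionCharpoly F M a := by
  rw [actionCharpoly_prod]
  exact (LinearMap.charpoly_eq_restrict_mul_mapQ (U.restrictScalars F) (Algebra.lsmul F F M a)
    fun x hx ↦ U.smul_mem a hx).symm

/-- Postcomposition with the quotient map, as an `F`-linear map between spaces of `A`-linear maps. -/
noncomputable def compMkQ (P : Type*) [AddCommGroup P] [Module F P] [Module A P]
    [IsScalarTower F A P] (U : Submodule A M) : (P →ₗ[A] M) →ₗ[F] (P →ₗ[A] M ⧸ U) where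
  toFun f := U.mkQ ∘ₗ f
  map_add' f g := LinearMap.comp_add f g U.mkQ
  map_smul' c f := by ext; rfl

theorem finrank_hom_le_finrank_range_compMkQ (U : Submodule A M) :
    finrank F (N →ₗ[A] M) ≤
      finrank F (N →ₗ[A] U) + finrank F (LinearMap.range (compMkQ F N U)) := by
  let ι : (N →ₗ[A] U) →ₗ[F] (N →ₗ[A] M) :=
    { toFun := fun f ↦ U.subtype ∘ₗ f
      map_add' := fun f g ↦ LinearMap.comp_add f g U.subtype
      map_smul' := fun c f ↦ by ext; rfl }
  have hker : LinearMap.ker (compMkQ F N U) ≤ LinearMap.range ι := fun f hf ↦ by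
    have hfU (x : N) : f x ∈ U := by
      rw [← Submodule.Quotient.mk_eq_zero]
      exact congrArg (fun g : N →ₗ[A] M ⧸ U ↦ g x) hf
    exact ⟨f.codRestrict U hfU, by ext; rfl⟩
  have h₁ := Submodule.finrank_mono hker
  have h₂ := LinearMap.finrank_range_le ι
  have h₃ := LinearMap.finrank_range_add_finrank_ker (compMkQ F N U)
  omega

theorem finrank_hom_le_of_submodule_right (U : Submodule A M) :
    finrank F (N →ₗ[A] M) ≤ finrank F (N →ₗ[A] U) + finrank F (N →ₗ[A] M ⧸ U) :=
  (finrank_hom_le_finrank_range_compMkQ F U).trans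
    (Nat.add_le_add_left (Submodule.finrank_le _) _)

theorem finrank_hom_lt_of_not_isComplemented {U : Submodule A M} (hU : ¬ IsComplemented U) :
    finrank F (M ⧸ U →ₗ[A] M) <
      finrank F (M ⧸ U →ₗ[A] U) + finrank F (M ⧸ U →ₗ[A] M ⧸ U) := by
  refine (finrank_hom_le_finrank_range_compMkQ F U).trans_lt
    (Nat.add_lt_add_left (Submodule.finrank_lt fun h ↦ hU ?_) _)
  obtain ⟨s, hs⟩ := LinearMap.range_eq_top.1 h LinearMap.id
  have hs' (q : M ⧸ U) : U.mkQ (s q) = q := LinearMap.congr_fun hs q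
  have hidem : IsIdempotentElem (s ∘ₗ U.mkQ : Module.End A M) :=
    LinearMap.ext fun x ↦ congrArg s (hs' (U.mkQ x))
  have hker : LinearMap.ker (s ∘ₗ U.mkQ) = U := by
    rw [LinearMap.ker_comp_of_ker_eq_bot _
      (LinearMap.ker_eq_bot.2 (Function.LeftInverse.injective hs')), U.ker_mkQ]
  have hc := (LinearMap.IsIdempotentElem.isCompl hidem).symm
  rw [hker] at hc
  exact ⟨_, hc⟩

theorem finrank_hom_le_of_submodule_left (U : Submodule A M) :
    finrank F (M →ₗ[A] N) ≤ finrank F (U →ₗ[A] N) + finrank F (M ⧸ U →ₗ[A] N) := by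
  let res : (M →ₗ[A] N) →ₗ[F] (U →ₗ[A] N) :=
    { toFun := fun f ↦ f ∘ₗ U.subtype
      map_add' := fun f g ↦ rfl
      map_smul' := fun c f ↦ rfl }
  let infl : (M ⧸ U →ₗ[A] N) →ₗ[F] (M →ₗ[A] N) :=
    { toFun := fun f ↦ f ∘ₗ U.mkQ
      map_add' := fun f g ↦ rfl
      map_smul' := fun c f ↦ rfl }
  have hker : LinearMap.ker res ≤ LinearMap.range infl := fun f hf ↦
    ⟨U.liftQ f fun x hx ↦ congrArg (fun g : U →ₗ[A] N ↦ g ⟨x, hx⟩) hf, U.liftQ_mkQ f _⟩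
  have h₁ := Submodule.finrank_mono hker
  have h₂ := LinearMap.finrank_range_le infl
  have h₃ := LinearMap.finrank_range_add_finrank_ker res
  have h₄ := Submodule.finrank_le (LinearMap.range res)
  omega

theorem finrank_end_lt_of_not_isComplemented {U : Submodule A M} (hU : ¬ IsComplemented U) :
    finrank F (M →ₗ[A] M) < finrank F (U × (M ⧸ U) →ₗ[A] U × (M ⧸ U)) := by
  have hprod : finrank F (U × (M ⧸ U) →ₗ[A] U × (M ⧸ U)) =
      (finrank F (U →ₗ[A] U) + finrank F (U →ₗ[A] M ⧸ U)) +
        (finrank F (M ⧸ U →ₗ[A] U) + finrank F (M ⧸ U →ₗ[A] M ⧸ U)) := by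
    rw [← (LinearMap.coprodEquiv F).finrank_eq, finrank_prod,
      ← (LinearMap.prodEquiv F).finrank_eq, ← (LinearMap.prodEquiv F).finrank_eq,
      finrank_prod, finrank_prod]
  have h₁ := finrank_hom_le_of_submodule_left F (N := M) U
  have h₂ := finrank_hom_le_of_submodule_right F (N := U) U
  have h₃ := finrank_hom_lt_of_not_isComplemented F hU
  omega

theorem finrank_end_le : finrank F (M →ₗ[A] M) ≤ finrank F M * finrank F M := by
  rw [← Module.finrank_linearMap F F M M]
  exact LinearMap.finrank_le_finrank_of_injective
    (f := LinearMap.restrictScalarsₗ F A M M F) (LinearMap.restrictScalars_injective F)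

theorem finrank_eq_of_actionCharpoly_eq
    (h : ∀ a : A, actionCharpoly F M a = actionCharpoly F N a) : finrank F M = finrank F N := by
  rw [← natDegree_actionCharpoly F (M := M) (0 : A), h, natDegree_actionCharpoly]

/-- A module which is not semisimple has a semisimple module with the same characteristic
polynomials and a strictly larger endomorphism algebra. -/
theorem exists_isSemisimpleModule_finrank_end_lt.{u} (k : ℕ) (M : Type u) [AddCommGroup M]
    [Module F M] [Module A M] [IsScalarTower F A M] [FiniteDimensional F M]
    (hk : finrank F M * finrank F M ≤ finrank F (M →ₗ[A] M) + k)
    (hM : ¬ IsSemisimpleModule A M) :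
    ∃ (N : Type u) (_ : AddCommGroup N) (_ : Module F N) (_ : Module A N)
      (_ : IsScalarTower F A N) (_ : FiniteDimensional F N), IsSemisimpleModule A N ∧
      (∀ a : A, actionCharpoly F M a = actionCharpoly F N a) ∧
      finrank F (M →ₗ[A] M) < finrank F (N →ₗ[A] N) := by
  rw [isSemisimpleModule_iff, complementedLattice_iff] at hM
  rw [not_forall] at hM
  obtain ⟨U, hU⟩ := hM
  have hlt := finrank_end_lt_of_not_isComplemented F hU
  have hchar (a : A) : actionCharpoly F M a = actionCharpoly F (U × (M ⧸ U)) a :=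
    (actionCharpoly_submodule_prod_quotient F U a).symm
  by_cases hss : IsSemisimpleModule A (U × (M ⧸ U))
  · exact ⟨_, _, _, _, inferInstance, inferInstance, hss, hchar, hlt⟩
  have hrank := finrank_eq_of_actionCharpoly_eq F hchar
  have hle := finrank_end_le F (A := A) (M := U × (M ⧸ U))
  cases k with
  | zero =>
    rw [← hrank] at hle
    omega
  | succ k =>
    obtain ⟨N, i₁, i₂, i₃, i₄, i₅, hN, hcharN, hltN⟩ :=
      exists_isSemisimpleModule_finrank_end_lt k (U × (M ⧸ U)) (by rw [← hrank]; omega) hss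
    exact ⟨N, i₁, i₂, i₃, i₄, i₅, hN, fun a ↦ (hchar a).trans (hcharN a), hlt.trans hltN⟩

theorem isRoot_actionCharpoly_one_iff (a : A) :
    (actionCharpoly F M a).IsRoot 1 ↔ ∃ x : M, x ≠ 0 ∧ a • x = x := by
  rw [actionCharpoly, ← Module.End.hasEigenvalue_iff_isRoot_charpoly]
  constructor
  · intro h
    obtain ⟨x, hx⟩ := h.exists_hasEigenvector
    exact ⟨x, hx.2, by simpa using hx.apply_eq_smul⟩
  · rintro ⟨x, hx, hax⟩
    exact Module.End.hasEigenvalue_of_hasEigenvector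
      (Module.End.hasEigenvector_iff.2 ⟨Module.End.mem_eigenspace_iff.2 (by simpa using hax), hx⟩)

theorem exists_linearMap_ne_zero_of_actionCharpoly_eq [IsSemisimpleModule A M]
    [IsSemisimpleModule A N] (h : ∀ a : A, actionCharpoly F M a = actionCharpoly F N a)
    (S : Submodule A M) [IsSimpleModule A S] : ∃ f : S →ₗ[A] N, f ≠ 0 := by
  by_contra! hSN
  have hNS (f : N →ₗ[A] S) : f = 0 := by
    by_contra hf
    obtain ⟨g, hg⟩ := IsSemisimpleModule.lifting_property f
      (LinearMap.surjective_of_ne_zero hf) LinearMap.id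
    rw [hSN g, LinearMap.comp_zero] at hg
    have := IsSimpleModule.nontrivial A S
    obtain ⟨x, hx⟩ := exists_ne (0 : S)
    exact hx (LinearMap.congr_fun hg x).symm
  obtain ⟨a, ha₁, ha₀⟩ := exists_smul_eq_self_and_smul_eq_zero F hSN hNS
  have := IsSimpleModule.nontrivial A S
  obtain ⟨x, hx⟩ := exists_ne (0 : S)
  obtain ⟨y, hy, hay⟩ := (isRoot_actionCharpoly_one_iff F a).1 <| h a ▸
    (isRoot_actionCharpoly_one_iff F (M := M) a).2
      ⟨x, by simpa using hx, congrArg Subtype.val (ha₁ x)⟩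
  exact hy (hay.symm.trans (ha₀ y))

/-- The Brauer–Nesbitt theorem: finite-dimensional semisimple modules over an algebra are
determined by their characteristic polynomials. -/
theorem nonempty_linearEquiv_of_actionCharpoly_eq.{u, v} (k : ℕ) (M : Type u) (N : Type v)
    [AddCommGroup M] [Module F M] [Module A M] [IsScalarTower F A M] [FiniteDimensional F M]
    [AddCommGroup N] [Module F N] [Module A N] [IsScalarTower F A N] [FiniteDimensional F N]
    [IsSemisimpleModule A M] [IsSemisimpleModule A N] (hk : finrank F M ≤ k)
    (h : ∀ a : A, actionCharpoly F M a = actionCharpoly F N a) : Nonempty (M ≃ₗ[A] N) := by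
  have hrank := finrank_eq_of_actionCharpoly_eq F h
  cases subsingleton_or_nontrivial M with
  | inl _ =>
    have : Subsingleton N := by
      rw [← Module.finrank_zero_iff (R := F), ← hrank, Module.finrank_zero_iff]
      infer_instance
    exact ⟨LinearEquiv.ofSubsingleton M N⟩
  | inr _ =>
    obtain ⟨S, hS⟩ := IsSemisimpleModule.exists_simple_submodule A M
    obtain ⟨f, hf⟩ := exists_linearMap_ne_zero_of_actionCharpoly_eq F h S
    obtain ⟨T, hT⟩ := exists_isCompl S
    obtain ⟨T', hT'⟩ := exists_isCompl (LinearMap.range f)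
    let e := LinearEquiv.ofInjective f (LinearMap.injective_of_ne_zero hf)
    let eM : (S × T) ≃ₗ[A] M := Submodule.prodEquivOfIsCompl S T hT
    let eN : (S × T') ≃ₗ[A] N := (e.prodCongr (.refl A T')).trans
      (Submodule.prodEquivOfIsCompl _ T' hT')
    have hTT' (a : A) : actionCharpoly F T a = actionCharpoly F T' a := by
      refine mul_left_cancel₀ (LinearMap.charpoly_monic (Algebra.lsmul F F S a)).ne_zero ?_
      change actionCharpoly F S a * _ = actionCharpoly F S a * _
      rw [← actionCharpoly_prod, ← actionCharpoly_prod, actionCharpoly_congr F eM,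
        actionCharpoly_congr F eN, h]
    have hSpos : 0 < finrank F S :=
      have := IsSimpleModule.nontrivial A S
      Module.finrank_pos
    have hsum : finrank F S + finrank F T = finrank F M := by
      rw [← finrank_prod, (eM.restrictScalars F).finrank_eq]
    cases k with
    | zero => omega
    | succ k =>
      obtain ⟨g⟩ := nonempty_linearEquiv_of_actionCharpoly_eq k T T' (by omega) hTT'
      exact ⟨eM.symm.trans (((LinearEquiv.refl A S).prodCongr g).trans eN)⟩

theorem isSemisimpleModule_of_finrank_end_le [IsSemisimpleModule A N]
    (h : ∀ a : A, actionCharpoly F M a = actionCharpoly F N a)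
    (hle : finrank F (N →ₗ[A] N) ≤ finrank F (M →ₗ[A] M)) : IsSemisimpleModule A M := by
  by_contra hM
  obtain ⟨L, _, _, _, _, _, _, hL, hlt⟩ :=
    exists_isSemisimpleModule_finrank_end_lt F _ M (Nat.le_add_left _ _) hM
  obtain ⟨e⟩ := nonempty_linearEquiv_of_actionCharpoly_eq F _ L N le_rfl
    fun a ↦ (hL a).symm.trans (h a)
  have : finrank F (L →ₗ[A] L) ≤ finrank F (N →ₗ[A] N) :=
    LinearMap.finrank_le_finrank_of_injective (f :=
      ({ toFun := fun f ↦ e.toLinearMap ∘ₗ f ∘ₗ e.symm.toLinearMap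
         map_add' := fun f g ↦ by ext; simp
         map_smul' := fun c f ↦ by ext x; exact (e.restrictScalars F).map_smul c _ } :
        (L →ₗ[A] L) →ₗ[F] (N →ₗ[A] N)))
      fun f g hfg ↦ by
        ext x
        simpa using LinearMap.congr_fun hfg (e x)
  omega

end CharpolyExact

section GroupAction

variable {F G V : Type} [Field F] [Group G] [AddCommGroup V] [Module F V]

/-- The representation of the group algebra attached to an action by linear automorphisms. -/
noncomputable def groupAlgebraRep (ρ : G →* (V ≃ₗ[F] V)) :
    MonoidAlgebra F G →ₐ[F] Module.End F V :=
  Representation.asAlgebraHom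
    ((LinearEquiv.automorphismGroup.toLinearMapMonoidHom (R := F) (M := V)).comp ρ)

theorem groupAlgebraRep_of (ρ : G →* (V ≃ₗ[F] V)) (g : G) :
    groupAlgebraRep ρ (.of F G g) = ((ρ g : V ≃ₗ[F] V) : Module.End F V) :=
  Representation.asAlgebraHom_of _ g

/-- The module over the group algebra attached to an action by linear automorphisms. -/
noncomputable abbrev groupAlgebraModule (ρ : G →* (V ≃ₗ[F] V)) : Module (MonoidAlgebra F G) V :=
  Module.compHom V (groupAlgebraRep ρ : MonoidAlgebra F G →+* Module.End F V)

theorem isScalarTower_groupAlgebraModule (ρ : G →* (V ≃ₗ[F] V)) :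
    letI := groupAlgebraModule ρ
    IsScalarTower F (MonoidAlgebra F G) V :=
  letI := groupAlgebraModule ρ
  ⟨fun c a x ↦ LinearMap.congr_fun (map_smul (groupAlgebraRep ρ) c a) x⟩

theorem span_range_of : Submodule.span F (Set.range (MonoidAlgebra.of F G)) = ⊤ := by
  refine Submodule.eq_top_iff'.2 fun a ↦ ?_
  induction a using MonoidAlgebra.induction_on with
  | of g => exact Submodule.subset_span ⟨g, rfl⟩
  | add a b ha hb => exact add_mem ha hb
  | smul c a ha => exact Submodule.smul_mem _ c ha

theorem mem_of_forall_group_mem (ρ : G →* (V ≃ₗ[F] V)) {U : Submodule F V}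
    (hU : ∀ g ∈ Set.range fun g ↦ ρ g, ∀ x ∈ U, g x ∈ U) (a : MonoidAlgebra F G) {x : V}
    (hx : x ∈ U) : groupAlgebraRep ρ a x ∈ U := by
  have ha : a ∈ Submodule.span F (Set.range (MonoidAlgebra.of F G)) :=
    span_range_of (F := F) (G := G) ▸ Submodule.mem_top
  induction ha using Submodule.span_induction with
  | mem a ha =>
    obtain ⟨g, rfl⟩ := ha
    rw [groupAlgebraRep_of]
    exact hU _ ⟨g, rfl⟩ x hx
  | zero => simp
  | add a b _ _ ha hb => simpa using U.add_mem ha hb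
  | smul c a _ ha => simpa using U.smul_mem c ha

theorem actsSemisimply_range_iff (ρ : G →* (V ≃ₗ[F] V)) :
    letI := groupAlgebraModule ρ
    ActsSemisimply (Set.range fun g ↦ ρ g) ↔ IsSemisimpleModule (MonoidAlgebra F G) V := by
  let := groupAlgebraModule ρ
  have : IsScalarTower F (MonoidAlgebra F G) V := isScalarTower_groupAlgebraModule ρ
  let toSub (U : Submodule F V) (hU : ∀ g ∈ Set.range fun g ↦ ρ g, ∀ x ∈ U, g x ∈ U) :
      Submodule (MonoidAlgebra F G) V :=
    { U with smul_mem' := fun a _ hx ↦ mem_of_forall_group_mem ρ hU a hx }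
  have stable (U : Submodule (MonoidAlgebra F G) V) :
      ∀ g ∈ Set.range fun g ↦ ρ g, ∀ x ∈ U.restrictScalars F, g x ∈ U.restrictScalars F := by
    rintro _ ⟨g, rfl⟩ x hx
    have := U.smul_mem (.of F G g) hx
    change groupAlgebraRep ρ _ x ∈ U at this
    rwa [groupAlgebraRep_of] at this
  have isCompl_iff (U U' : Submodule (MonoidAlgebra F G) V) :
      IsCompl (U.restrictScalars F) (U'.restrictScalars F) ↔ IsCompl U U' := by
    rw [isCompl_iff, isCompl_iff, Submodule.disjoint_def, Submodule.disjoint_def,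
      codisjoint_iff, codisjoint_iff, Submodule.eq_top_iff', Submodule.eq_top_iff']
    simp [Submodule.mem_sup]
  rw [isSemisimpleModule_iff, complementedLattice_iff]
  constructor
  · intro h U
    obtain ⟨U', hU', hc⟩ := h (U.restrictScalars F) (stable U)
    exact ⟨toSub U' hU', (isCompl_iff U (toSub U' hU')).1 hc⟩
  · intro h U hU
    obtain ⟨U', hc⟩ := h (toSub U hU)
    exact ⟨U'.restrictScalars F, stable U', (isCompl_iff (toSub U hU) U').2 hc⟩

theorem commutantDim_range (ρ : G →* (V ≃ₗ[F] V)) :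
    letI := groupAlgebraModule ρ
    letI : IsScalarTower F (MonoidAlgebra F G) V := isScalarTower_groupAlgebraModule ρ
    commutantDim (Set.range fun g ↦ ρ g) = finrank F (V →ₗ[MonoidAlgebra F G] V) := by
  let := groupAlgebraModule ρ
  let : IsScalarTower F (MonoidAlgebra F G) V := isScalarTower_groupAlgebraModule ρ
  have comm (f : Subalgebra.centralizer F ((fun g : V ≃ₗ[F] V => (g : Module.End F V)) ''
      (Set.range fun g ↦ ρ g))) (a : MonoidAlgebra F G) (x : V) :
      (f : Module.End F V) (groupAlgebraRep ρ a x) =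
        groupAlgebraRep ρ a ((f : Module.End F V) x) := by
    have ha : a ∈ Submodule.span F (Set.range (MonoidAlgebra.of F G)) :=
      span_range_of (F := F) (G := G) ▸ Submodule.mem_top
    induction ha using Submodule.span_induction with
    | mem a ha =>
      obtain ⟨g, rfl⟩ := ha
      rw [groupAlgebraRep_of]
      exact (LinearMap.congr_fun ((Subalgebra.mem_centralizer_iff F).1 f.2 _ ⟨_, ⟨g, rfl⟩, rfl⟩)
        x).symm
    | zero => simp
    | add a b _ _ ha hb => simp [ha, hb]
    | smul c a _ ha => simp [ha]
  refine LinearEquiv.finrank_eq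
    { toFun := fun f ↦ { (f : Module.End F V) with map_smul' := fun a x ↦ comm f a x }
      map_add' := fun _ _ ↦ rfl
      map_smul' := fun _ _ ↦ rfl
      invFun := fun f ↦ ⟨f.restrictScalars F, ?_⟩
      left_inv := fun _ ↦ rfl
      right_inv := fun _ ↦ rfl }
  rw [Subalgebra.mem_centralizer_iff]
  rintro _ ⟨_, ⟨g, rfl⟩, rfl⟩
  ext x
  have := f.map_smul (.of F G g) x
  change f (groupAlgebraRep ρ _ x) = groupAlgebraRep ρ _ (f x) at this
  rw [groupAlgebraRep_of] at this
  exact this.symm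

theorem charpoly_groupAlgebraRep_eq [FiniteDimensional F V] {W : Type} [AddCommGroup W]
    [Module F W] [FiniteDimensional F W] (ρ : G →* (V ≃ₗ[F] V)) (σ : G →* (W ≃ₗ[F] W))
    (h : ∀ g : G, LinearMap.charpoly ((ρ g : V ≃ₗ[F] V) : Module.End F V) =
      LinearMap.charpoly ((σ g : W ≃ₗ[F] W) : Module.End F W)) (a : MonoidAlgebra F G) :
    (groupAlgebraRep ρ a).charpoly = (groupAlgebraRep σ a).charpoly := by
  have hrank : finrank F V = finrank F W := by
    rw [← LinearMap.charpoly_natDegree ((ρ 1 : V ≃ₗ[F] V) : Module.End F V), h,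
      LinearMap.charpoly_natDegree]
  let b := finBasisOfFinrankEq F V hrank
  let b' := finBasis F W
  have key := Matrix.charpoly_eq_of_span_eq_top
    ((LinearMap.toMatrixAlgEquiv b).toAlgHom.comp (groupAlgebraRep ρ))
    ((LinearMap.toMatrixAlgEquiv b').toAlgHom.comp (groupAlgebraRep σ)) span_range_of
    (by
      rintro _ ⟨g, rfl⟩
      change (LinearMap.toMatrix b b (groupAlgebraRep ρ _)).charpoly =
        (LinearMap.toMatrix b' b' (groupAlgebraRep σ _)).charpoly
      rw [LinearMap.charpoly_toMatrix, LinearMap.charpoly_toMatrix, groupAlgebraRep_of,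
        groupAlgebraRep_of, h]) a
  change (LinearMap.toMatrix b b (groupAlgebraRep ρ _)).charpoly =
    (LinearMap.toMatrix b' b' (groupAlgebraRep σ _)).charpoly at key
  rwa [LinearMap.charpoly_toMatrix, LinearMap.charpoly_toMatrix] at key

end GroupAction

/-- `F` a perfect field, `V` a finite-dimensional `F`-vector space,
`G ⊆ GL(V)` a subgroup, `Vss` the semisimplification of `V` as a `G`-representation
(characterized à la Brauer–Nesbitt: semisimple with the same characteristic polynomials),
acted on by `G` through `ρ` with image `G^red`.  If
`dim_F End_G(V) ≥ dim_F End_{G^red}(Vss)` then `V` is a semisimple `G`-representation. -/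
theorem stmt_4 (F V Vss : Type) [Field F] [PerfectField F]
    [AddCommGroup V] [Module F V] [FiniteDimensional F V]
    [AddCommGroup Vss] [Module F Vss] [FiniteDimensional F Vss]
    (G : Subgroup (V ≃ₗ[F] V)) (ρ : G →* (Vss ≃ₗ[F] Vss))
    (hss : ActsSemisimply (Set.range fun g : G => ρ g))
    (hchar : ∀ g : G,
      LinearMap.charpoly ((g : V ≃ₗ[F] V) : Module.End F V) =
      LinearMap.charpoly ((ρ g : Vss ≃ₗ[F] Vss) : Module.End F Vss))
    (hdim : commutantDim (G : Set (V ≃ₗ[F] V)) ≥ commutantDim (Set.range fun g : G => ρ g)) :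
    ActsSemisimply (G : Set (V ≃ₗ[F] V)) := by
  have hrange : (G : Set (V ≃ₗ[F] V)) = Set.range fun g : G ↦ G.subtype g := by simp
  rw [hrange] at hdim ⊢
  let := groupAlgebraModule G.subtype
  let : IsScalarTower F (MonoidAlgebra F G) V :=
    isScalarTower_groupAlgebraModule G.subtype
  let := groupAlgebraModule ρ
  let : IsScalarTower F (MonoidAlgebra F G) Vss :=
    isScalarTower_groupAlgebraModule ρ
  rw [commutantDim_range, commutantDim_range] at hdim
  have := (actsSemisimply_range_iff ρ).1 hss
  exact (actsSemisimply_range_iff G.subtype).2 <|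
    isSemisimpleModule_of_finrank_end_le F (N := Vss)
      (charpoly_groupAlgebraRep_eq G.subtype ρ hchar) hdim
end

section
/- Let $F$ be a finite extension of $\mathbb{Q}_\ell$ with residue field of cardinality $q$, and suppose $\ell > k$. Then the number of totally ramified abelian extensions of $F$ of degree at most $k$ (inside a fixed algebraic closure) is at most $k^2$. -/
section Ultrametric

variable {K : Type*}

theorem norm_add_pow_sub_le [NormedField K] [IsUltrametricDist K] {x h : K} (hx : ‖x‖ ≤ 1)
    (hh : ‖h‖ ≤ 1) (n : ℕ) :
    ‖(x + h) ^ (n + 1) - x ^ (n + 1) - (n + 1 : ℕ) * x ^ n * h‖ ≤ ‖h‖ ^ 2 := by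
  induction n with
  | zero => simp
  | succ n ih =>
    have key : (x + h) ^ (n + 1 + 1) - x ^ (n + 1 + 1) - (n + 1 + 1 : ℕ) * x ^ (n + 1) * h =
        ((x + h) ^ (n + 1) - x ^ (n + 1) - (n + 1 : ℕ) * x ^ n * h) * (x + h) +
          (n + 1 : ℕ) * x ^ n * h ^ 2 := by
      push_cast; ring
    have hxh : ‖x + h‖ ≤ 1 := (IsUltrametricDist.norm_add_le_max x h).trans (max_le hx hh)
    rw [key]
    refine (IsUltrametricDist.norm_add_le_max _ _).trans (max_le ?_ ?_)
    · rw [norm_mul]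
      exact (mul_le_of_le_one_right (norm_nonneg _) hxh).trans ih
    · rw [norm_mul, norm_mul, norm_pow, norm_pow]
      exact mul_le_of_le_one_left (by positivity) (mul_le_one₀
        (IsUltrametricDist.norm_natCast_le_one K _) (by positivity)
        (pow_le_one₀ (norm_nonneg _) hx))

theorem norm_eq_one_of_norm_sub_lt_one [NormedField K] [IsUltrametricDist K] {x y : K}
    (hy : ‖y‖ = 1) (h : ‖x - y‖ < 1) : ‖x‖ = 1 := by
  have := IsUltrametricDist.norm_add_eq_max_of_norm_ne_norm (x := x - y) (y := y) (by
    rw [hy]; exact h.ne)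
  rw [sub_add_cancel, hy, max_eq_right h.le] at this
  exact this

/-- A form of Hensel's lemma for the polynomial `X ^ n - a`. -/
theorem exists_pow_eq_of_norm_pow_sub_lt_one [NormedField K] [ProperSpace K] [IsUltrametricDist K]
    {n : ℕ} (hn : ‖(n : K)‖ = 1) {a x₀ : K} (hx₀ : ‖x₀‖ = 1) (h : ‖x₀ ^ n - a‖ < 1) :
    ∃ x : K, x ^ n = a ∧ ‖x - x₀‖ < 1 := by
  obtain ⟨m, rfl⟩ : ∃ m, n = m + 1 := Nat.exists_eq_succ_of_ne_zero (by
    rintro rfl; simp at hn)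
  have hc : IsCompact (Metric.ball x₀ 1) :=
    (isCompact_closedBall x₀ 1).of_isClosed_subset (IsUltrametricDist.isClosed_ball _ _)
      Metric.ball_subset_closedBall
  obtain ⟨x, hx, hmin⟩ := hc.exists_isMinOn ⟨x₀, Metric.mem_ball_self one_pos⟩
    (f := fun x => ‖x ^ (m + 1) - a‖) (by fun_prop)
  rw [isMinOn_iff] at hmin
  rw [mem_ball_iff_norm] at hx
  refine ⟨x, ?_, hx⟩
  by_contra hne
  have hx1 : ‖x‖ = 1 := norm_eq_one_of_norm_sub_lt_one hx₀ hx
  have hpos : 0 < ‖x ^ (m + 1) - a‖ := norm_pos_iff.2 (sub_ne_zero.2 hne)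
  have hlt : ‖x ^ (m + 1) - a‖ < 1 := (hmin x₀ (Metric.mem_ball_self one_pos)).trans_lt h
  have hd : ‖((m + 1 : ℕ) : K) * x ^ m‖ = 1 := by rw [norm_mul, hn, norm_pow, hx1]; simp
  have hd0 : ((m + 1 : ℕ) : K) * x ^ m ≠ 0 := by
    rw [← norm_pos_iff, hd]; exact one_pos
  set t := -(x ^ (m + 1) - a) / (((m + 1 : ℕ) : K) * x ^ m) with ht
  have htn : ‖t‖ = ‖x ^ (m + 1) - a‖ := by rw [ht, norm_div, hd, norm_neg, div_one]
  have hmem : x + t ∈ Metric.ball x₀ 1 := by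
    rw [mem_ball_iff_norm, add_sub_right_comm]
    exact (IsUltrametricDist.norm_add_le_max _ _).trans_lt (max_lt hx (htn ▸ hlt))
  have h1 := hmin _ hmem
  have h2 := norm_add_pow_sub_le hx1.le (htn ▸ hlt.le) m
  have h3 : ((m + 1 : ℕ) : K) * x ^ m * t = -(x ^ (m + 1) - a) := by
    rw [ht, mul_div_cancel₀ _ hd0]
  rw [h3, htn, show (x + t) ^ (m + 1) - x ^ (m + 1) - -(x ^ (m + 1) - a) =
    (x + t) ^ (m + 1) - a by ring] at h2
  nlinarith

theorem exists_norm_eq_zpow (K : Type*) [NontriviallyNormedField K] [ProperSpace K]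
    [IsUltrametricDist K] :
    ∃ ϖ : K, ϖ ≠ 0 ∧ ‖ϖ‖ < 1 ∧ ∀ x : K, x ≠ 0 → ∃ j : ℤ, ‖x‖ = ‖ϖ‖ ^ j := by
  have hc : IsCompact (Metric.ball (0 : K) 1) :=
    (isCompact_closedBall 0 1).of_isClosed_subset (IsUltrametricDist.isClosed_ball _ _)
      Metric.ball_subset_closedBall
  obtain ⟨ϖ, hϖ, hmax⟩ := hc.exists_isMaxOn ⟨0, Metric.mem_ball_self one_pos⟩
    (f := fun x => ‖x‖) (by fun_prop)
  rw [isMaxOn_iff] at hmax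
  rw [mem_ball_zero_iff] at hϖ
  obtain ⟨y, hy, hy1⟩ := NormedField.exists_norm_lt_one K
  have hpos : 0 < ‖ϖ‖ := hy.trans_le (hmax y (mem_ball_zero_iff.2 hy1))
  refine ⟨ϖ, norm_pos_iff.1 hpos, hϖ, fun x hx => ?_⟩
  obtain ⟨j, hj1, hj2⟩ := exists_mem_Ioc_zpow (norm_pos_iff.2 hx) ((one_lt_inv₀ hpos).2 hϖ)
  refine ⟨-(j + 1), ?_⟩
  have hn : ‖x * ϖ ^ (j + 1)‖ = ‖x‖ * ‖ϖ‖ ^ (j + 1) := by rw [norm_mul, norm_zpow]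
  rw [inv_zpow'] at hj1 hj2
  have hpj : 0 < ‖ϖ‖ ^ (j + 1) := by positivity
  rw [zpow_neg] at hj2 ⊢
  replace hj2 : ‖x‖ * ‖ϖ‖ ^ (j + 1) ≤ 1 :=
    (mul_le_mul_of_nonneg_right hj2 hpj.le).trans_eq (inv_mul_cancel₀ hpj.ne')
  have h1 : ‖ϖ‖ < ‖x‖ * ‖ϖ‖ ^ (j + 1) := by
    calc ‖ϖ‖ = ‖ϖ‖ ^ (-j) * ‖ϖ‖ ^ (j + 1) := by
          rw [← zpow_add₀ hpos.ne']; simp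
      _ < _ := by gcongr
  refine eq_inv_of_mul_eq_one_left ?_
  by_contra hne
  exact absurd (hmax _ (mem_ball_zero_iff.2 (hn ▸ lt_of_le_of_ne hj2 hne))) (by
    rw [hn]; exact not_le.2 h1)

open scoped NormedField Valued in
theorem exists_norm_pow_sub_one_lt_one (K : Type*) [NontriviallyNormedField K] [ProperSpace K]
    [IsUltrametricDist K] {ℓ : ℕ} [Fact ℓ.Prime] (hℓ : ‖(ℓ : K)‖ < 1) :
    ∃ N : ℕ, 0 < N ∧ ¬ ℓ ∣ N ∧ ∀ u : K, ‖u‖ = 1 → ‖u ^ N - 1‖ < 1 := by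
  have hO : ∀ x : K, x ∈ 𝒪[K] ↔ ‖x‖ ≤ 1 := fun x => Valued.integer.mem_iff
  have hcpt : CompactSpace 𝒪[K] := by
    rw [← isCompact_univ_iff, Subtype.isCompact_iff, Set.image_univ, Subtype.range_coe]
    convert isCompact_closedBall (0 : K) 1
    ext x
    simp [hO]
  have : (Valued.v : Valuation K NNReal).IsNontrivial :=
    inferInstanceAs (NormedField.valuation (K := K)).IsNontrivial
  have : IsDiscreteValuationRing 𝒪[K] := Valued.integer.isDiscreteValuationRing_of_compactSpace
  have hfin : Finite 𝓀[K] := inferInstance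
  have hmax : ∀ x : 𝒪[K], IsLocalRing.residue 𝒪[K] x = 0 ↔ ‖(x : K)‖ < 1 := by
    intro x
    rw [IsLocalRing.residue_eq_zero_iff, IsLocalRing.mem_maximalIdeal, mem_nonunits_iff,
      Valued.integer.isUnit_iff_norm_eq_one]
    exact ⟨fun h => lt_of_le_of_ne ((hO x).1 x.2) h, fun h => h.ne⟩
  have hchar : CharP 𝓀[K] ℓ := by
    have h0 : ((ℓ : ℕ) : 𝓀[K]) = 0 := by
      rw [← map_natCast (IsLocalRing.residue 𝒪[K]), hmax]
      simpa using hℓ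
    exact (CharP.charP_iff_prime_eq_zero Fact.out).2 h0
  have := Fintype.ofFinite 𝓀[K]
  obtain ⟨f, -, hf⟩ := FiniteField.card 𝓀[K] ℓ
  have h1 : 1 < Fintype.card 𝓀[K] := Fintype.one_lt_card
  refine ⟨Fintype.card 𝓀[K] - 1, by omega, fun hdvd => ?_, fun u hu => ?_⟩
  · have h2 : ℓ ∣ Fintype.card 𝓀[K] := hf ▸ dvd_pow_self _ f.ne_zero
    have h3 := (Nat.dvd_sub_iff_right h1.le h2).1 hdvd
    exact (Fact.out : ℓ.Prime).one_lt.ne' (Nat.dvd_one.1 h3)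
  · have h2 := (hmax (⟨u, (hO u).2 hu.le⟩ ^ (Fintype.card 𝓀[K] - 1) - 1)).1 (by
      rw [map_sub, map_pow, map_one, sub_eq_zero]
      exact FiniteField.pow_card_sub_one_eq_one _ (by
        rw [Ne, hmax]; exact hu.not_lt))
    simpa using h2

theorem exists_pow_eq_one_norm_sub_lt_one (K : Type*) [NontriviallyNormedField K] [ProperSpace K]
    [IsUltrametricDist K] {ℓ : ℕ} [Fact ℓ.Prime] (hℓ : ‖(ℓ : K)‖ < 1)
    (hℓ' : ∀ m : ℕ, ¬ ℓ ∣ m → ‖(m : K)‖ = 1) :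
    ∃ N : ℕ, 0 < N ∧ ¬ ℓ ∣ N ∧ ∀ u : K, ‖u‖ = 1 → ∃ c : K, c ^ N = 1 ∧ ‖u - c‖ < 1 := by
  obtain ⟨N, hN, hdvd, h⟩ := exists_norm_pow_sub_one_lt_one K hℓ
  refine ⟨N, hN, hdvd, fun u hu => ?_⟩
  obtain ⟨c, hc, hcu⟩ := exists_pow_eq_of_norm_pow_sub_lt_one (hℓ' N hdvd) hu (h u hu)
  exact ⟨c, hc, by rwa [norm_sub_rev]⟩

theorem exists_norm_sub_pow_lt_one (K : Type*) [NontriviallyNormedField K] [ProperSpace K]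
    [IsUltrametricDist K] {ℓ : ℕ} [Fact ℓ.Prime] (hℓ : ‖(ℓ : K)‖ < 1)
    (hℓ' : ∀ m : ℕ, ¬ ℓ ∣ m → ‖(m : K)‖ = 1) :
    ∃ ζ : K, ‖ζ‖ = 1 ∧ ∀ u : K, ‖u‖ = 1 → ∃ i : ℕ, ‖u - ζ ^ i‖ < 1 := by
  obtain ⟨N, hN, -, h⟩ := exists_pow_eq_one_norm_sub_lt_one K hℓ hℓ'
  have : NeZero N := ⟨hN.ne'⟩
  obtain ⟨ζ, hζ⟩ := IsCyclic.exists_generator (α := rootsOfUnity N K)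
  refine ⟨((ζ : Kˣ) : K), ?_, fun u hu => ?_⟩
  · have h1 : ((ζ : Kˣ) : K) ^ N = 1 := by
      have := (mem_rootsOfUnity' N (ζ : Kˣ)).1 ζ.2
      exact this
    exact (pow_eq_one_iff_of_nonneg (norm_nonneg _) hN.ne').1 (by rw [← norm_pow, h1, norm_one])
  · obtain ⟨c, hc, huc⟩ := h u hu
    obtain ⟨i, hi⟩ := (mem_powers_iff_mem_zpowers (x := ζ)).2 (hζ (rootsOfUnity.mkOfPowEq c hc))
    refine ⟨i, ?_⟩
    have h2 := congrArg (fun z : rootsOfUnity N K => ((z : Kˣ) : K)) hi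
    simp only [rootsOfUnity.coe_mkOfPowEq] at h2
    rw [← h2] at huc
    simpa using huc

end Ultrametric

section TotallyRamified

open IntermediateField

/-- An immediate extension of degree prime to the residue characteristic is trivial. -/
theorem eq_top_of_forall_exists_norm_eq {F L : Type*} [Field F] [NormedField L]
    [IsUltrametricDist L] [Algebra F L] [FiniteDimensional F L] [IsGalois F L]
    (hσ : ∀ (σ : L ≃ₐ[F] L) (x : L), ‖σ x‖ = ‖x‖)
    (M : IntermediateField F L) (hd : ‖(Module.finrank M L : L)‖ = 1)
    (hM : ∀ x : L, x ≠ 0 → ∃ m ∈ M, ‖x‖ = ‖m‖)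
    (hF : ∀ u : L, ‖u‖ = 1 → ∃ c ∈ M, ‖u - c‖ < 1) : M = ⊤ := by
  have htr : ∀ x : L, ‖x‖ < 1 → ‖algebraMap M L (Algebra.trace M L x)‖ < 1 := by
    intro x hx
    rw [trace_eq_sum_automorphisms]
    obtain ⟨σ, -, hle⟩ := IsUltrametricDist.exists_norm_finsetSum_le Finset.univ
      (fun σ : L ≃ₐ[M] L => σ x)
    exact hle.trans_lt ((hσ (σ.restrictScalars F) x).trans_lt hx)
  have hd0 : (Module.finrank M L : L) ≠ 0 := norm_pos_iff.1 (hd ▸ one_pos)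
  have hd0' : (Module.finrank M L : M) ≠ 0 := fun h => hd0 (by
    simpa using congrArg (algebraMap M L) h)
  have htr0 : ∀ x : L, Algebra.trace M L x = 0 → x = 0 := by
    intro x hx
    by_contra hne
    obtain ⟨m, hm, hxm⟩ := hM x hne
    have hm0 : ‖m‖ ≠ 0 := by rw [← hxm]; exact norm_ne_zero_iff.2 hne
    have hu : ‖m⁻¹ * x‖ = 1 := by rw [norm_mul, norm_inv, hxm, inv_mul_cancel₀ hm0]
    obtain ⟨c, hc, hcu⟩ := hF _ hu
    have hc1 : ‖c‖ = 1 := norm_eq_one_of_norm_sub_lt_one hu (by rwa [norm_sub_rev])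
    have h1 := htr _ hcu
    have h2 : Algebra.trace M L (m⁻¹ * x) = 0 := by
      have : m⁻¹ * x = (⟨m, hm⟩ : M)⁻¹ • x := by rw [Algebra.smul_def]; simp
      rw [this, map_smul, hx, smul_zero]
    have h3 : Algebra.trace M L c = Module.finrank M L • (⟨c, hc⟩ : M) :=
      Algebra.trace_algebraMap (⟨c, hc⟩ : M)
    rw [map_sub, h2, h3, zero_sub, map_neg, norm_neg, map_nsmul, nsmul_eq_mul, norm_mul, hd,
      one_mul] at h1
    exact absurd hc1 (ne_of_lt h1)
  refine eq_top_iff.2 fun x _ => ?_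
  have h := htr0 (x - algebraMap M L ((Module.finrank M L : M)⁻¹ * Algebra.trace M L x)) (by
    rw [map_sub, Algebra.trace_algebraMap, nsmul_eq_mul, mul_inv_cancel_left₀ hd0', sub_self])
  rw [sub_eq_zero] at h
  rw [h]
  exact ((Module.finrank M L : M)⁻¹ * Algebra.trace M L x).2

/-- A totally tamely ramified Galois extension is generated by a root of a uniformizer of the base
field, up to a root of unity. -/
theorem exists_pow_eq_of_totallyRamified {F L : Type*} [Field F] [NontriviallyNormedField L]
    [ProperSpace L] [IsUltrametricDist L] [Algebra F L] [FiniteDimensional F L] [IsGalois F L]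
    {ℓ : ℕ} [Fact ℓ.Prime] (hℓ : ‖(ℓ : L)‖ < 1)
    (hℓ' : ∀ m : ℕ, ¬ ℓ ∣ m → ‖(m : L)‖ = 1) (hσ : ∀ (σ : L ≃ₐ[F] L) (x : L), ‖σ x‖ = ‖x‖)
    {ϖ ζ : F} (hϖ0 : ϖ ≠ 0) (hϖ1 : ‖algebraMap F L ϖ‖ < 1)
    (hϖ : ∀ x : F, x ≠ 0 → ∃ j : ℤ, ‖algebraMap F L x‖ = ‖algebraMap F L ϖ‖ ^ j)
    (hζ1 : ‖algebraMap F L ζ‖ = 1)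
    (hζ : ∀ u : F, ‖algebraMap F L u‖ = 1 → ∃ i : ℕ, ‖algebraMap F L (u - ζ ^ i)‖ < 1)
    (hn : Module.finrank F L < ℓ)
    (hram : ∀ z : L, (∃ m : ℕ, 0 < m ∧ ¬ ℓ ∣ m ∧ z ^ m = 1) → ∃ x : F, algebraMap F L x = z) :
    ∃ i < Module.finrank F L, ∃ α : L,
      α ^ Module.finrank F L = algebraMap F L (ζ ^ i * ϖ) ∧ F⟮α⟯ = ⊤ := by
  have hres : ∀ u : L, ‖u‖ = 1 → ∃ i : ℕ, ‖u - algebraMap F L (ζ ^ i)‖ < 1 := by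
    intro u hu
    obtain ⟨N, hN, hdvd, h⟩ := exists_pow_eq_one_norm_sub_lt_one L hℓ hℓ'
    obtain ⟨c, hc, huc⟩ := h u hu
    obtain ⟨c, rfl⟩ := hram c ⟨N, hN, hdvd, hc⟩
    obtain ⟨i, hi⟩ := hζ c (norm_eq_one_of_norm_sub_lt_one hu (by rwa [norm_sub_rev]))
    refine ⟨i, ?_⟩
    rw [map_sub] at hi
    have := (IsUltrametricDist.norm_add_le_max _ _).trans_lt (max_lt huc hi)
    rwa [sub_add_sub_cancel] at this
  have hlt : ∀ m : ℕ, 0 < m → m < ℓ → ‖(m : L)‖ = 1 := fun m h0 h1 =>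
    hℓ' m (Nat.not_dvd_of_pos_of_lt h0 h1)
  have hn0 : 0 < Module.finrank F L := Module.finrank_pos
  obtain ⟨P, hP0, hP1, hP⟩ := exists_norm_eq_zpow L
  have hPpos : 0 < ‖P‖ := norm_pos_iff.2 hP0
  have hϖ0' : algebraMap F L ϖ ≠ 0 := by simpa using hϖ0
  obtain ⟨e, he⟩ := hP _ hϖ0'
  obtain ⟨e, rfl⟩ : ∃ e' : ℕ, e = e' := Int.eq_ofNat_of_zero_le (by
    by_contra! h
    rw [he] at hϖ1
    exact absurd (one_le_zpow_of_nonpos₀ hPpos hP1.le h.le) (not_le.2 hϖ1))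
  have he0 : e ≠ 0 := by
    rintro rfl
    simp [he] at hϖ1
  rw [zpow_natCast] at he
  have hen : e ≤ Module.finrank F L := by
    have h1 : ‖algebraMap F L (Algebra.norm F P)‖ = ‖P‖ ^ Module.finrank F L := by
      rw [Algebra.norm_eq_prod_automorphisms, norm_prod]
      simp only [hσ]
      rw [Finset.prod_const, Finset.card_univ, ← Nat.card_eq_fintype_card,
        IsGalois.card_aut_eq_finrank]
    obtain ⟨j, hj⟩ := hϖ (Algebra.norm F P) (Algebra.norm_ne_zero_iff.2 hP0)
    rw [h1, he, ← zpow_natCast, ← zpow_natCast, ← zpow_mul] at hj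
    have h2 := zpow_right_injective₀ hPpos hP1.ne hj
    exact Nat.le_of_dvd hn0 (Int.natCast_dvd_natCast.1 ⟨j, h2⟩)
  have hunit : ‖P ^ e / algebraMap F L ϖ‖ = 1 := by
    rw [norm_div, norm_pow, he, div_self (by positivity)]
  obtain ⟨i, hi⟩ := hres _ hunit
  have hPe : P ^ e ≠ 0 := pow_ne_zero _ hP0
  obtain ⟨s, hs, hs1⟩ := exists_pow_eq_of_norm_pow_sub_lt_one (K := L) (n := e)
    (a := algebraMap F L (ζ ^ i * ϖ) / P ^ e) (x₀ := 1)
    (hlt e (Nat.pos_of_ne_zero he0) (hen.trans_lt hn)) norm_one (by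
      have : (1 : L) ^ e - algebraMap F L (ζ ^ i * ϖ) / P ^ e =
          (P ^ e / algebraMap F L ϖ)⁻¹ * (P ^ e / algebraMap F L ϖ - algebraMap F L (ζ ^ i)) := by
        rw [map_mul, one_pow]; field_simp
      rw [this, norm_mul, norm_inv, hunit]
      simpa using hi)
  have hs1 : ‖s‖ = 1 := norm_eq_one_of_norm_sub_lt_one norm_one hs1
  obtain ⟨α, hα, hαP⟩ : ∃ α : L, α ^ e = algebraMap F L (ζ ^ i * ϖ) ∧ ‖α‖ = ‖P‖ :=
    ⟨s * P, by rw [mul_pow, hs, div_mul_cancel₀ _ hPe], by rw [norm_mul, hs1, one_mul]⟩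
  have htop : F⟮α⟯ = ⊤ := by
    refine eq_top_of_forall_exists_norm_eq hσ _ (hlt _ Module.finrank_pos ?_) (fun x hx => ?_)
      (fun u hu => ?_)
    · refine lt_of_le_of_lt ?_ hn
      rw [← Module.finrank_mul_finrank F F⟮α⟯ L]
      exact Nat.le_mul_of_pos_left _ Module.finrank_pos
    · obtain ⟨j, hj⟩ := hP x hx
      exact ⟨α ^ j, zpow_mem (mem_adjoin_simple_self F α) j, by rw [hj, norm_zpow, hαP]⟩
    · obtain ⟨i, hi⟩ := hres u hu
      exact ⟨_, IntermediateField.algebraMap_mem _ _, hi⟩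
  have hne : Module.finrank F L = e := by
    refine le_antisymm ?_ hen
    rw [← IntermediateField.finrank_top', ← htop,
      adjoin.finrank (Algebra.IsIntegral.isIntegral α)]
    have h1 : Polynomial.X ^ e - Polynomial.C (ζ ^ i * ϖ) ≠ 0 :=
      Polynomial.X_pow_sub_C_ne_zero (Nat.pos_of_ne_zero he0) _
    refine (Polynomial.natDegree_le_of_dvd (minpoly.dvd F α (by simp [hα])) h1).trans ?_
    rw [Polynomial.natDegree_X_pow_sub_C]
  rw [hne]
  have hζ0 : algebraMap F L ζ ≠ 0 := norm_pos_iff.1 (hζ1 ▸ one_pos)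
  refine ⟨i % e, Nat.mod_lt _ (Nat.pos_of_ne_zero he0), α / algebraMap F L (ζ ^ (i / e)), ?_, ?_⟩
  · rw [div_pow, hα, div_eq_iff (by simp [hζ0]), ← map_pow, ← map_mul]
    congr 1
    conv_lhs => rw [← Nat.mod_add_div i e]
    ring
  · rw [eq_top_iff, ← htop, adjoin_simple_le_iff]
    have h1 := mul_mem (mem_adjoin_simple_self F (α / algebraMap F L (ζ ^ (i / e))))
      (IntermediateField.algebraMap_mem _ (ζ ^ (i / e)))
    rwa [div_mul_cancel₀ _ (by simp [hζ0])] at h1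

end TotallyRamified

section Padic

variable (ℓ : ℕ) [Fact ℓ.Prime]

theorem isUltrametricDist_spectralNorm (E : Type*) [Field E] [Algebra ℚ_[ℓ] E]
    [FiniteDimensional ℚ_[ℓ] E] :
    letI := spectralNorm.nontriviallyNormedField ℚ_[ℓ] E
    IsUltrametricDist E :=
  letI := spectralNorm.nontriviallyNormedField ℚ_[ℓ] E
  IsUltrametricDist.isUltrametricDist_of_forall_norm_add_le_max_norm
    (isNonarchimedean_spectralNorm (K := ℚ_[ℓ]) (L := E))

theorem properSpace_spectralNorm (E : Type*) [Field E] [Algebra ℚ_[ℓ] E]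
    [FiniteDimensional ℚ_[ℓ] E] :
    letI := spectralNorm.nontriviallyNormedField ℚ_[ℓ] E
    ProperSpace E :=
  letI := spectralNorm.nontriviallyNormedField ℚ_[ℓ] E
  letI := spectralNorm.normedSpace ℚ_[ℓ] E
  FiniteDimensional.proper ℚ_[ℓ] E

theorem spectralNorm_natCast (E : Type*) [Field E] [Algebra ℚ_[ℓ] E]
    [FiniteDimensional ℚ_[ℓ] E] (m : ℕ) : spectralNorm ℚ_[ℓ] E m = ‖(m : ℚ_[ℓ])‖ := by
  rw [← map_natCast (algebraMap ℚ_[ℓ] E), spectralNorm_extends]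

theorem spectralNorm_natCast_self_lt_one (E : Type*) [Field E] [Algebra ℚ_[ℓ] E]
    [FiniteDimensional ℚ_[ℓ] E] : spectralNorm ℚ_[ℓ] E ℓ < 1 := by
  rw [spectralNorm_natCast]
  exact Padic.norm_p_lt_one

theorem spectralNorm_natCast_eq_one (E : Type*) [Field E] [Algebra ℚ_[ℓ] E]
    [FiniteDimensional ℚ_[ℓ] E] {m : ℕ} (hm : ¬ ℓ ∣ m) : spectralNorm ℚ_[ℓ] E m = 1 := by
  rw [spectralNorm_natCast, Padic.norm_natCast_eq_one_iff]
  exact (Nat.Prime.coprime_iff_not_dvd Fact.out).2 hm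

theorem exists_uniformizer_and_rootOfUnity (F : Type*) [Field F] [Algebra ℚ_[ℓ] F]
    [FiniteDimensional ℚ_[ℓ] F] :
    ∃ ϖ ζ : F, ϖ ≠ 0 ∧ spectralNorm ℚ_[ℓ] F ϖ < 1 ∧
      (∀ x : F, x ≠ 0 → ∃ j : ℤ, spectralNorm ℚ_[ℓ] F x = spectralNorm ℚ_[ℓ] F ϖ ^ j) ∧
      spectralNorm ℚ_[ℓ] F ζ = 1 ∧
      ∀ u : F, spectralNorm ℚ_[ℓ] F u = 1 → ∃ i : ℕ, spectralNorm ℚ_[ℓ] F (u - ζ ^ i) < 1 := by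
  let := spectralNorm.nontriviallyNormedField ℚ_[ℓ] F
  have := isUltrametricDist_spectralNorm ℓ F
  have := properSpace_spectralNorm ℓ F
  obtain ⟨ϖ, h0, h1, h⟩ := exists_norm_eq_zpow F
  obtain ⟨ζ, hζ⟩ := exists_norm_sub_pow_lt_one F (spectralNorm_natCast_self_lt_one ℓ F)
    (fun m hm => spectralNorm_natCast_eq_one ℓ F hm)
  exact ⟨ϖ, ζ, h0, h1, h, hζ⟩

open IntermediateField in
theorem exists_generators_of_totallyRamified (F : Type*) [Field F] [Algebra ℚ_[ℓ] F]
    [FiniteDimensional ℚ_[ℓ] F] :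
    ∃ a : ℕ → F, ∀ (L : Type*) [Field L] [Algebra F L] [FiniteDimensional F L] [IsGalois F L],
      Module.finrank F L < ℓ →
      (∀ z : L, (∃ m : ℕ, 0 < m ∧ ¬ ℓ ∣ m ∧ z ^ m = 1) → ∃ x : F, algebraMap F L x = z) →
      ∃ i < Module.finrank F L, ∃ α : L,
        α ^ Module.finrank F L = algebraMap F L (a i) ∧ F⟮α⟯ = ⊤ := by
  obtain ⟨ϖ, ζ, hϖ0, hϖ1, hϖ, hζ1, hζ⟩ := exists_uniformizer_and_rootOfUnity ℓ F
  refine ⟨fun i => ζ ^ i * ϖ, fun L _ _ _ _ hn hram => ?_⟩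
  let : Algebra ℚ_[ℓ] L := ((algebraMap F L).comp (algebraMap ℚ_[ℓ] F)).toAlgebra
  have : IsScalarTower ℚ_[ℓ] F L := IsScalarTower.of_algebraMap_eq fun _ => rfl
  have : FiniteDimensional ℚ_[ℓ] L := FiniteDimensional.trans ℚ_[ℓ] F L
  let := spectralNorm.nontriviallyNormedField ℚ_[ℓ] L
  have := isUltrametricDist_spectralNorm ℓ L
  have := properSpace_spectralNorm ℓ L
  have hF : ∀ x : F, ‖algebraMap F L x‖ = spectralNorm ℚ_[ℓ] F x := fun x =>
    (spectralNorm.eq_of_tower x).symm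
  refine exists_pow_eq_of_totallyRamified (spectralNorm_natCast_self_lt_one ℓ L)
    (fun m hm => spectralNorm_natCast_eq_one ℓ L hm)
    (fun σ x => (spectralNorm_eq_of_equiv (σ.restrictScalars ℚ_[ℓ]) x).symm) hϖ0 ?_ ?_ ?_ ?_ hn hram
  · rwa [hF]
  · simpa only [hF] using hϖ
  · rwa [hF]
  · simpa only [hF] using hζ

end Padic

section Adjoin

open IntermediateField Polynomial

theorem minpoly_eq_X_pow_sub_C {F E : Type*} [Field F] [Field E] [Algebra F E] {a : F} {n : ℕ}
    (hn : n ≠ 0) {α : E} (hα : α ^ n = algebraMap F E a) (h : n ≤ Module.finrank F F⟮α⟯) :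
    minpoly F α = X ^ n - C a := by
  have hint : IsIntegral F α := ⟨X ^ n - C a, monic_X_pow_sub_C a hn, by simp [hα]⟩
  rw [adjoin.finrank hint] at h
  have hdvd : minpoly F α ∣ X ^ n - C a := minpoly.dvd F α (by simp [hα])
  refine (eq_of_monic_of_dvd_of_natDegree_le (minpoly.monic hint) (monic_X_pow_sub_C a hn)
    hdvd ?_).symm
  rwa [natDegree_X_pow_sub_C]

theorem adjoin_simple_eq_of_pow_eq {F E : Type*} [Field F] [Field E] [Algebra F E] [Normal F E]
    (L : IntermediateField F E) [Normal F L] {a : F} {n : ℕ} (hn : n ≠ 0)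
    (hL : n ≤ Module.finrank F L) {α β : E} (hα : α ^ n = algebraMap F E a)
    (hβ : β ^ n = algebraMap F E a) (h : F⟮α⟯ = L) : F⟮β⟯ = L := by
  have hmin := minpoly_eq_X_pow_sub_C hn hα (h ▸ hL)
  have hconj : IsConjRoot F α β := by
    refine minpoly.eq_of_irreducible_of_monic (minpoly.irreducible
      (Algebra.IsIntegral.isIntegral α)) ?_ (minpoly.monic (Algebra.IsIntegral.isIntegral α))
    simp [hmin, hβ]
  obtain ⟨σ, hσ⟩ := isConjRoot_iff_exists_algEquiv.1 hconj.symm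
  have h1 := normal_iff_forall_map_eq'.1 ‹Normal F L› σ
  rw [← h, adjoin_map, Set.image_singleton] at h1
  rw [← h, ← h1, ← hσ]
  rfl

end Adjoin


/-- Let `F` be a finite extension of `ℚ_ℓ` and `k < ℓ`.  Then the number
of totally ramified abelian extensions of `F` of degree at most `k` inside a fixed
algebraic closure is at most `k²`.  Here an extension `L/F` is abelian if it is finite
Galois with commutative Galois group, and (for local fields with residue characteristic
`ℓ`) `L/F` is totally ramified iff every root of unity in `L` of order prime to `ℓ`
already lies in `F` (i.e. `L` contains no nontrivial unramified subextension). -/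
theorem stmt_9 (ℓ k : ℕ) [Fact ℓ.Prime] (hk : 1 ≤ k) (hkℓ : k < ℓ)
    (F : Type) [Field F] [Algebra ℚ_[ℓ] F] [FiniteDimensional ℚ_[ℓ] F] :
    Set.ncard {L : IntermediateField F (AlgebraicClosure F) |
      FiniteDimensional F ↥L ∧
      Module.finrank F ↥L ≤ k ∧
      IsGalois F ↥L ∧
      (∀ σ τ : ↥L ≃ₐ[F] ↥L, σ * τ = τ * σ) ∧
      (∀ ζ : ↥L, (∃ m : ℕ, 0 < m ∧ ¬(ℓ ∣ m) ∧ ζ ^ m = 1) →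
        ∃ x : F, algebraMap F ↥L x = ζ)} ≤ k ^ 2 := by
  classical
  obtain ⟨a, ha⟩ := exists_generators_of_totallyRamified ℓ F
  choose! β hβ using fun (n : ℕ) (i : ℕ) (hn : 0 < n) =>
    IsAlgClosed.exists_pow_nat_eq (algebraMap F (AlgebraicClosure F) (a i)) hn
  let g : ℕ × ℕ → IntermediateField F (AlgebraicClosure F) := fun p =>
    IntermediateField.adjoin F {β p.1 p.2}
  let T : Finset (IntermediateField F (AlgebraicClosure F)) :=
    (Finset.Icc 1 k ×ˢ Finset.range k).image g
  refine (Set.ncard_le_ncard (t := (T : Set _)) ?_ T.finite_toSet).trans ?_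
  · rintro L ⟨hfin, hdeg, hgal, -, hram⟩
    obtain ⟨i, hi, α, hα, htop⟩ := ha L (hdeg.trans_lt hkℓ) hram
    have hpos : 0 < Module.finrank F L := Module.finrank_pos
    have hL : IntermediateField.adjoin F {(α : AlgebraicClosure F)} = L := by
      have h := congrArg IntermediateField.lift htop
      rwa [IntermediateField.lift_adjoin_simple, IntermediateField.lift_top] at h
    simp only [T, Finset.coe_image, Set.mem_image, Finset.mem_coe, Finset.mem_product,
      Finset.mem_Icc, Finset.mem_range]
    refine ⟨(Module.finrank F L, i), ⟨⟨hpos, hdeg⟩, hi.trans_le hdeg⟩, ?_⟩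
    exact adjoin_simple_eq_of_pow_eq L hpos.ne' le_rfl (congrArg Subtype.val hα)
      (hβ _ i hpos) hL
  · rw [Set.ncard_coe_finset]
    refine Finset.card_image_le.trans ?_
    rw [Finset.card_product, Nat.card_Icc, Finset.card_range, Nat.add_sub_cancel, sq]
end
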